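/- arXiv:1103.2059 — 12 statements merged into one kernel-verified Lean document; each statement's English description precedes it below -/
import Mathlib

section
/- Let A be an n×n real symmetric matrix (n > 1) with nonnegative entries that is irreducible, ρ its Perron root, and 0 < t < ρ^{-1}. Write R_t = (I − tA)^{-1} with entries r_{ij}(t). Then R_t satisfies the transition inequality: for all indices i, j, k one has r_{ij}(t) · r_{jk}(t) ≤ r_{ik}(t) · r_{jj}(t). -/
open Matrix

theorem walk_max_principle
    {n : ℕ} (A : Matrix (Fin n) (Fin n) ℝ) (hA : ∀ i j, 0 ≤ A i j)
    (ρ : ℝ) (hρ : 0 < ρ) (p : Fin n → ℝ) (hp : ∀ i, 0 < p i)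
    (hAp : A.mulVec p = ρ • p)
    (t : ℝ) (ht0 : 0 < t) (ht1 : t < ρ⁻¹) (v : Fin n → ℝ)
    (hv : ∀ i, 0 ≤ v i ∨ 0 ≤ ((1 - t • A).mulVec v) i) : ∀ i, 0 ≤ v i := by
  by_contra! hneg
  obtain ⟨i0, hi0⟩ := hneg
  obtain ⟨i, -, hi⟩ := Finset.exists_min_image Finset.univ (fun l => v l / p l) ⟨i0, Finset.mem_univ _⟩
  set m := v i / p i with hm
  have hmneg : m < 0 := lt_of_le_of_lt (hi i0 (Finset.mem_univ _)) (div_neg_of_neg_of_pos hi0 (hp i0))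
  have hvi : v i = m * p i := by rw [hm, div_mul_cancel₀ _ (hp i).ne']
  have hvl : ∀ l, m * p l ≤ v l := fun l => (le_div_iff₀ (hp l)).1 (hi l (Finset.mem_univ _))
  have hpi := hp i
  have hvneg : v i < 0 := by rw [hvi]; exact mul_neg_of_neg_of_pos hmneg hpi
  have h1 : 0 ≤ ((1 - t • A).mulVec v) i := (hv i).resolve_left (not_le.2 hvneg)
  rw [Matrix.sub_mulVec, Matrix.one_mulVec, Matrix.smul_mulVec] at h1
  simp only [Pi.sub_apply, Pi.smul_apply, smul_eq_mul] at h1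
  have h2 : m * (ρ * p i) ≤ A.mulVec v i := by
    have := congrFun hAp i
    simp only [Pi.smul_apply, smul_eq_mul] at this
    rw [← this]
    simp only [Matrix.mulVec, dotProduct, Finset.mul_sum]
    refine Finset.sum_le_sum fun l _ => ?_
    have := mul_le_mul_of_nonneg_left (hvl l) (hA i l)
    linarith
  have h3 : t * ρ < 1 := by
    have := mul_lt_mul_of_pos_right ht1 hρ
    rwa [inv_mul_cancel₀ hρ.ne'] at this
  have h4 := mul_le_mul_of_nonneg_left h2 ht0.le
  have h5 : m * p i * (1 - t * ρ) < 0 :=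
    mul_neg_of_neg_of_pos (mul_neg_of_neg_of_pos hmneg hpi) (by linarith)
  nlinarith

/-- The matrix of walk weights `R_t = (I - tA)⁻¹` satisfies the transition
inequality `r_ij · r_jk ≤ r_ik · r_jj`. -/
theorem walk_weights_transition_inequality
    {n : ℕ} (hn : 1 < n) (A : Matrix (Fin n) (Fin n) ℝ)
    (hsym : A.IsSymm) (hA : ∀ i j, 0 ≤ A i j)
    (hirr : ∀ i j : Fin n, i ≠ j → ∃ k : ℕ, 1 ≤ k ∧ 0 < (A ^ k) i j)
    (ρ : ℝ) (hρ : 0 < ρ) (p : Fin n → ℝ) (hp : ∀ i, 0 < p i)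
    (hAp : A.mulVec p = ρ • p)
    (hspec : ∀ (μ : ℝ) (v : Fin n → ℝ), v ≠ 0 → A.mulVec v = μ • v → |μ| ≤ ρ)
    (t : ℝ) (ht0 : 0 < t) (ht1 : t < ρ⁻¹) :
    ∀ i j k : Fin n,
      (1 - t • A)⁻¹ i j * (1 - t • A)⁻¹ j k ≤ (1 - t • A)⁻¹ i k * (1 - t • A)⁻¹ j j := by
  intro i j k
  have key := walk_max_principle A hA ρ hρ p hp hAp t ht0 ht1
  have hunit : IsUnit (1 - t • A) := by
    rw [← Matrix.mulVec_injective_iff_isUnit]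
    intro x y hxy
    have h0 : (1 - t • A).mulVec (x - y) = 0 := by
      rw [Matrix.mulVec_sub]; exact sub_eq_zero.2 hxy
    have h0' : (1 - t • A).mulVec (y - x) = 0 := by
      rw [Matrix.mulVec_sub]; exact sub_eq_zero.2 hxy.symm
    have a := key (x - y) (fun i => Or.inr (by rw [h0]; simp))
    have b := key (y - x) (fun i => Or.inr (by rw [h0']; simp))
    funext l
    have := a l
    have := b l
    simp only [Pi.sub_apply] at *
    linarith
  have hMR : (1 - t • A) * (1 - t • A)⁻¹ = 1 :=
    Matrix.mul_nonsing_inv _ ((Matrix.isUnit_iff_isUnit_det _).1 hunit)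
  set M := 1 - t • A with hM
  set R := M⁻¹ with hR
  have hcol : ∀ c, M.mulVec (fun l => R l c) = fun l => (1 : Matrix (Fin n) (Fin n) ℝ) l c := by
    intro c
    rw [← hMR]
    rfl
  have hone : ∀ a b, 0 ≤ (1 : Matrix (Fin n) (Fin n) ℝ) a b := by
    intro a b
    rw [Matrix.one_apply]
    split_ifs <;> norm_num
  have hjj : 0 ≤ R j j := key (fun l => R l j) (fun l => Or.inr (by rw [hcol]; exact hone _ _)) j
  have := key (R j j • (fun l => R l k) - R j k • (fun l => R l j)) (fun l => by
    by_cases hl : l = j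
    · left
      subst hl
      simp [mul_comm]
    · right
      rw [Matrix.mulVec_sub, Matrix.mulVec_smul, Matrix.mulVec_smul, hcol, hcol]
      simp only [Pi.sub_apply, Pi.smul_apply, smul_eq_mul]
      rw [Matrix.one_apply_ne hl, mul_zero, sub_zero]
      exact mul_nonneg hjj (hone _ _)) i
  simp only [Pi.sub_apply, Pi.smul_apply, smul_eq_mul] at this
  linarith
end

section
/- Let A be an n×n real symmetric matrix (n > 1) with nonnegative entries that is irreducible, ρ its Perron root, and 0 < t < ρ^{-1}. Define d_t(i,j) = −ln( r_{ij}(t) / √( r_{ii}(t) · r_{jj}(t) ) ), where r_{ij}(t) are the entries of R_t = (I − tA)^{-1}. Then d_t is a metric on the index set: d_t(i,j) ≥ 0 with equality if and only if i = j; d_t(i,j) = d_t(j,i); and d_t(i,j) + d_t(j,k) ≥ d_t(i,k) for all i, j, k. -/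
open Matrix

/-- Minimum principle for `1 - tA`. -/
lemma walk_min_principle {n : ℕ} (A : Matrix (Fin n) (Fin n) ℝ) (hA : ∀ i j, 0 ≤ A i j)
    (ρ : ℝ) (p : Fin n → ℝ) (hp : ∀ i, 0 < p i) (hAp : A.mulVec p = ρ • p)
    (t : ℝ) (ht0 : 0 < t) (ht : t * ρ < 1) (x : Fin n → ℝ)
    (hx : ∀ i, t * ∑ j, A i j * x j ≤ x i ∨ 0 ≤ x i) : ∀ i, 0 ≤ x i := by
  intro i₀
  obtain ⟨i, -, hi⟩ := Finset.exists_min_image Finset.univ (fun i => x i / p i)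
    ⟨i₀, Finset.mem_univ i₀⟩
  have key : 0 ≤ x i := by
    rcases hx i with h | h
    · have h1 : ∑ j, A i j * ((x i / p i) * p j) ≤ ∑ j, A i j * x j := by
        apply Finset.sum_le_sum
        intro j _
        apply mul_le_mul_of_nonneg_left _ (hA i j)
        exact (le_div_iff₀ (hp j)).1 (hi j (Finset.mem_univ j))
      have h2 : ∑ j, A i j * ((x i / p i) * p j) = ρ * x i := by
        have h3 : ∑ j, A i j * p j = ρ * p i := by
          have := congrFun hAp i
          simpa [Matrix.mulVec, dotProduct] using this
        have h4 : ∑ j, A i j * ((x i / p i) * p j) = (x i / p i) * ∑ j, A i j * p j := by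
          rw [Finset.mul_sum]
          exact Finset.sum_congr rfl fun j _ => by ring
        rw [h4, h3]
        have := (hp i).ne'
        field_simp
      rw [h2] at h1
      have h5 := mul_le_mul_of_nonneg_left h1 ht0.le
      by_contra hneg
      push Not at hneg
      nlinarith
    · exact h
  have h1 : 0 ≤ x i / p i := div_nonneg key (hp i).le
  have h2 := hi i₀ (Finset.mem_univ i₀)
  have h3 := (le_div_iff₀ (hp i₀)).1 (h1.trans h2)
  simpa using h3

/-- The walk distance `d_t(i,j) = -ln( r_ij / √(r_ii r_jj) )` is a metric. -/
theorem walk_distance_is_metric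
    {n : ℕ} (hn : 1 < n) (A : Matrix (Fin n) (Fin n) ℝ)
    (hsym : A.IsSymm) (hA : ∀ i j, 0 ≤ A i j)
    (hirr : ∀ i j : Fin n, i ≠ j → ∃ k : ℕ, 1 ≤ k ∧ 0 < (A ^ k) i j)
    (ρ : ℝ) (hρ : 0 < ρ) (p : Fin n → ℝ) (hp : ∀ i, 0 < p i)
    (hAp : A.mulVec p = ρ • p)
    (hspec : ∀ (μ : ℝ) (v : Fin n → ℝ), v ≠ 0 → A.mulVec v = μ • v → |μ| ≤ ρ)
    (t : ℝ) (ht0 : 0 < t) (ht1 : t < ρ⁻¹)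
    (d : Fin n → Fin n → ℝ)
    (hd : ∀ i j, d i j =
      -Real.log ((1 - t • A)⁻¹ i j /
        Real.sqrt ((1 - t • A)⁻¹ i i * (1 - t • A)⁻¹ j j))) :
    (∀ i j, 0 ≤ d i j) ∧
    (∀ i j, d i j = 0 ↔ i = j) ∧
    (∀ i j, d i j = d j i) ∧
    (∀ i j k, d i k ≤ d i j + d j k) := by
  have ht : t * ρ < 1 := by
    have := mul_lt_mul_of_pos_right ht1 hρ
    rwa [inv_mul_cancel₀ hρ.ne'] at this
  have hmp := walk_min_principle A hA ρ p hp hAp t ht0 ht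
  have hunit : IsUnit (1 - t • A) := by
    rw [← Matrix.mulVec_injective_iff_isUnit]
    have h0 : ∀ x : Fin n → ℝ, (1 - t • A).mulVec x = 0 → ∀ i, 0 ≤ x i := by
      intro x hx
      apply hmp
      intro i
      left
      have := congrFun hx i
      rw [Matrix.sub_mulVec, Matrix.one_mulVec, Matrix.smul_mulVec] at this
      simp only [Pi.sub_apply, Pi.smul_apply, smul_eq_mul, Matrix.mulVec, dotProduct,
        Pi.zero_apply] at this
      linarith
    intro x y hxy
    ext i
    have h1 := h0 (x - y) (by rw [Matrix.mulVec_sub]; exact sub_eq_zero.2 hxy) i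
    have h2 := h0 (y - x) (by rw [Matrix.mulVec_sub]; exact sub_eq_zero.2 hxy.symm) i
    simp only [Pi.sub_apply] at h1 h2
    linarith
  have hMR : (1 - t • A) * (1 - t • A)⁻¹ = 1 :=
    Matrix.mul_nonsing_inv _ ((Matrix.isUnit_iff_isUnit_det _).1 hunit)
  have hRsymm : ((1 - t • A)⁻¹)ᵀ = (1 - t • A)⁻¹ := by
    rw [Matrix.transpose_nonsing_inv]
    simp [hsym.eq]
  generalize hR : (1 - t • A)⁻¹ = R at *
  have hs : ∀ i j, R i j = R j i := fun i j => by
    conv_lhs => rw [← hRsymm]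
    rfl
  have hrec : ∀ i k, R i k = (1 : Matrix (Fin n) (Fin n) ℝ) i k + t * ∑ j, A i j * R j k := by
    intro i k
    have := congrFun (congrFun hMR i) k
    rw [sub_mul, one_mul, Matrix.smul_mul, Matrix.sub_apply, Matrix.smul_apply,
      Matrix.mul_apply, smul_eq_mul] at this
    linarith
  have hone : ∀ i k, 0 ≤ (1 : Matrix (Fin n) (Fin n) ℝ) i k := by
    intro i k
    rw [Matrix.one_apply]
    split_ifs <;> norm_num
  have hnn : ∀ i k, 0 ≤ R i k := by
    intro i k
    apply hmp (fun i => R i k)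
    intro i
    left
    have := hrec i k
    have := hone i k
    linarith
  have hpow : ∀ m : ℕ, ∀ i k, t ^ m * (A ^ m) i k ≤ R i k := by
    intro m
    induction m with
    | zero =>
      intro i k
      have h1 := hrec i k
      have h2 : 0 ≤ ∑ j, A i j * R j k :=
        Finset.sum_nonneg fun j _ => mul_nonneg (hA i j) (hnn j k)
      have h3 := mul_nonneg ht0.le h2
      simp only [pow_zero, one_mul]
      linarith
    | succ m ih =>
      intro i k
      have h1 := hrec i k
      have h2 := hone i k
      have h3 : t ^ (m + 1) * (A ^ (m + 1)) i k = t * ∑ j, A i j * (t ^ m * (A ^ m) j k) := by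
        rw [pow_succ' A, Matrix.mul_apply, Finset.mul_sum, Finset.mul_sum]
        exact Finset.sum_congr rfl fun j _ => by ring
      have h4 : ∑ j, A i j * (t ^ m * (A ^ m) j k) ≤ ∑ j, A i j * R j k :=
        Finset.sum_le_sum fun j _ => mul_le_mul_of_nonneg_left (ih j k) (hA i j)
      have h5 := mul_le_mul_of_nonneg_left h4 ht0.le
      linarith
  have hpos : ∀ i k, 0 < R i k := by
    intro i k
    by_cases h : i = k
    · subst h
      have := hpow 0 i i
      simp only [pow_zero, one_mul, Matrix.one_apply_eq] at this
      linarith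
    · obtain ⟨m, -, hm⟩ := hirr i k h
      exact lt_of_lt_of_le (mul_pos (pow_pos ht0 m) hm) (hpow m i k)
  have hxrec : ∀ i j k, R i k * R j j - R i j * R j k
      = (1 : Matrix (Fin n) (Fin n) ℝ) i k * R j j - (1 : Matrix (Fin n) (Fin n) ℝ) i j * R j k
        + t * ∑ l, A i l * (R l k * R j j - R l j * R j k) := by
    intro i j k
    have e : ∑ l, A i l * (R l k * R j j - R l j * R j k)
        = (∑ l, A i l * R l k) * R j j - (∑ l, A i l * R l j) * R j k := by
      rw [Finset.sum_mul, Finset.sum_mul, ← Finset.sum_sub_distrib]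
      exact Finset.sum_congr rfl fun l _ => by ring
    rw [e]
    have h1 := hrec i k
    have h2 := hrec i j
    linear_combination R j j * h1 - R j k * h2
  have htri : ∀ i j k, 0 ≤ R i k * R j j - R i j * R j k := by
    intro i j k
    apply hmp (fun i => R i k * R j j - R i j * R j k)
    intro i
    by_cases h : i = j
    · right
      subst h
      exact le_of_eq (by ring)
    · left
      have h1 := hxrec i j k
      rw [Matrix.one_apply_ne h] at h1
      have h2 := mul_nonneg (hone i k) (hnn j j)
      linarith
  have hstrict : ∀ i j, i ≠ j → R i j * R i j < R i i * R j j := by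
    intro i j h
    have h1 := hxrec i j i
    rw [Matrix.one_apply_ne h, Matrix.one_apply_eq] at h1
    have h2 : 0 ≤ ∑ l, A i l * (R l i * R j j - R l j * R j i) :=
      Finset.sum_nonneg fun l _ => mul_nonneg (hA i l) (htri l j i)
    have h3 := mul_nonneg ht0.le h2
    have h4 := hpos j j
    rw [hs j i] at h1 h3
    linarith
  have hd' : ∀ i j, d i j = (Real.log (R i i) + Real.log (R j j)) / 2 - Real.log (R i j) := by
    intro i j
    have h1 := mul_pos (hpos i i) (hpos j j)
    rw [hd, Real.log_div (hpos i j).ne' (Real.sqrt_pos.2 h1).ne', Real.log_sqrt h1.le,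
      Real.log_mul (hpos i i).ne' (hpos j j).ne']
    ring
  have hself : ∀ i, d i i = 0 := fun i => by rw [hd']; ring
  have hlt : ∀ i j, i ≠ j → 0 < d i j := by
    intro i j h
    have h1 := Real.log_lt_log (mul_pos (hpos i j) (hpos i j)) (hstrict i j h)
    rw [Real.log_mul (hpos i j).ne' (hpos i j).ne',
      Real.log_mul (hpos i i).ne' (hpos j j).ne'] at h1
    rw [hd']
    linarith
  refine ⟨fun i j => ?_, fun i j => ⟨fun h => ?_, fun h => ?_⟩, fun i j => ?_, fun i j k => ?_⟩
  · by_cases h : i = j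
    · rw [h, hself]
    · exact (hlt i j h).le
  · by_contra hne
    exact (hlt i j hne).ne' h
  · rw [h, hself]
  · rw [hd', hd', hs i j]
    ring
  · have h1 := Real.log_le_log (mul_pos (hpos i j) (hpos j k)) (sub_nonneg.1 (htri i j k))
    rw [Real.log_mul (hpos i j).ne' (hpos j k).ne',
      Real.log_mul (hpos i k).ne' (hpos j j).ne'] at h1
    rw [hd', hd', hd']
    linarith
end

section
/- Let A be an n×n real symmetric matrix (n > 1) with nonnegative entries that is irreducible, ρ its Perron root, and 0 < t < ρ^{-1}. Let A_ĵĵ be the submatrix of A with row j and column j deleted, and a_ĵj the j-th column of A with its j-th entry deleted. Then the matrix I − t·A_ĵĵ is invertible, and for every index i ≠ j the entries of R_t = (I − tA)^{-1} satisfy r_{ij}(t) = r_{jj}(t) · ( (t^{-1} I − A_ĵĵ)^{-1} a_ĵj )_i. (That is, the ratio r_{ij}/r_{jj} equals the weight of the set of i→j hitting walks.) -/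
open Matrix

/-- The principal submatrix of `M` with row `j` and column `j` deleted. -/
noncomputable def delSub {n : ℕ} (M : Matrix (Fin n) (Fin n) ℝ) (j : Fin n) :
    Matrix {i : Fin n // i ≠ j} {i : Fin n // i ≠ j} ℝ :=
  M.submatrix Subtype.val Subtype.val

/-- The `j`-th column of `A` with its `j`-th entry deleted. -/
noncomputable def delCol {n : ℕ} (A : Matrix (Fin n) (Fin n) ℝ) (j : Fin n) :
    {i : Fin n // i ≠ j} → ℝ :=
  fun k => A k j

/-- A nonnegative matrix with a positive sub-eigenvector `q` for `ρ` has `1 - t B` invertible when `t ρ < 1`. -/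
lemma isUnit_det_one_sub_smul {ι : Type*} [Fintype ι] [DecidableEq ι] (B : Matrix ι ι ℝ)
    (hB : ∀ i j, 0 ≤ B i j) (q : ι → ℝ) (hq : ∀ i, 0 < q i) (ρ t : ℝ)
    (hBq : ∀ i, ∑ k, B i k * q k ≤ ρ * q i) (ht0 : 0 < t) (ht1 : t * ρ < 1) :
    IsUnit (1 - t • B).det := by
  rw [isUnit_iff_ne_zero]
  intro h0
  obtain ⟨v, hv, hBv⟩ := Matrix.exists_mulVec_eq_zero_iff.mpr h0
  obtain ⟨i0, hi0⟩ := Function.ne_iff.mp hv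
  obtain ⟨i, -, hi⟩ := Finset.exists_max_image Finset.univ (fun k => |v k| / q k)
    ⟨i0, Finset.mem_univ _⟩
  have hc : 0 < |v i| / q i :=
    lt_of_lt_of_le (div_pos (abs_pos.mpr hi0) (hq i0)) (hi i0 (Finset.mem_univ _))
  set c := |v i| / q i with hcdef
  have hvi : |v i| = c * q i := by rw [hcdef, div_mul_cancel₀ _ (hq i).ne']
  have hle : ∀ k, |v k| ≤ c * q k := fun k => (div_le_iff₀ (hq k)).mp (hi k (Finset.mem_univ _))
  have he : v i = t * ∑ k, B i k * v k := by
    have := congrFun hBv i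
    rw [Matrix.sub_mulVec, Matrix.one_mulVec, Matrix.smul_mulVec] at this
    simp only [Pi.sub_apply,
      Pi.smul_apply, Pi.zero_apply, smul_eq_mul, Matrix.mulVec, dotProduct] at this
    linarith
  have h1 : |∑ k, B i k * v k| ≤ c * (ρ * q i) := by
    calc |∑ k, B i k * v k| ≤ ∑ k, |B i k * v k| := Finset.abs_sum_le_sum_abs _ _
      _ ≤ ∑ k, c * (B i k * q k) := by
        refine Finset.sum_le_sum fun k _ => ?_
        rw [abs_mul, abs_of_nonneg (hB i k)]
        nlinarith [mul_le_mul_of_nonneg_left (hle k) (hB i k)]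
      _ = c * ∑ k, B i k * q k := by rw [Finset.mul_sum]
      _ ≤ _ := mul_le_mul_of_nonneg_left (hBq i) hc.le
  have h2 : c * q i ≤ t * (c * (ρ * q i)) := by
    rw [← hvi]
    conv_lhs => rw [he]
    rw [abs_mul, abs_of_pos ht0]
    exact mul_le_mul_of_nonneg_left h1 ht0.le
  have h3 : 0 < c * q i := mul_pos hc (hq i)
  nlinarith [mul_lt_mul_of_pos_right ht1 h3]

/-- `I - t A_ĵĵ` is invertible and
`r_ij(t) = r_jj(t) · ((t⁻¹ I - A_ĵĵ)⁻¹ a_ĵj)_i` for `i ≠ j`. -/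
theorem walk_weights_hitting_decomposition
    {n : ℕ} (hn : 1 < n) (A : Matrix (Fin n) (Fin n) ℝ)
    (hsym : A.IsSymm) (hA : ∀ i j, 0 ≤ A i j)
    (hirr : ∀ i j : Fin n, i ≠ j → ∃ k : ℕ, 1 ≤ k ∧ 0 < (A ^ k) i j)
    (ρ : ℝ) (hρ : 0 < ρ) (p : Fin n → ℝ) (hp : ∀ i, 0 < p i)
    (hAp : A.mulVec p = ρ • p)
    (hspec : ∀ (μ : ℝ) (v : Fin n → ℝ), v ≠ 0 → A.mulVec v = μ • v → |μ| ≤ ρ)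
    (t : ℝ) (ht0 : 0 < t) (ht1 : t < ρ⁻¹) :
    ∀ j : Fin n,
      IsUnit (1 - t • delSub A j).det ∧
      ∀ i : Fin n, ∀ hij : i ≠ j,
        (1 - t • A)⁻¹ i j =
          (1 - t • A)⁻¹ j j *
            ((t⁻¹ • (1 : Matrix {i : Fin n // i ≠ j} {i : Fin n // i ≠ j} ℝ)
              - delSub A j)⁻¹.mulVec (delCol A j)) ⟨i, hij⟩ := by
  intro j
  have htρ : t * ρ < 1 := by
    have := mul_lt_mul_of_pos_right ht1 hρ
    rwa [inv_mul_cancel₀ hρ.ne'] at this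
  have hrow : ∀ i, ∑ k, A i k * p k = ρ * p i := fun i => by
    simpa [Matrix.mulVec, dotProduct] using congrFun hAp i
  have hsplit : ∀ f : Fin n → ℝ, ∑ k, f k = f j + ∑ k : {i : Fin n // i ≠ j}, f k := fun f => by
    rw [← Fintype.sum_subtype_add_sum_subtype (fun k => k = j) f]
    simp only [Fintype.sum_unique, add_left_inj]
    exact congrArg f (Subtype.prop (p := fun k => k = j) _)
  have hUA : IsUnit (1 - t • A).det :=
    isUnit_det_one_sub_smul A hA p hp ρ t (fun i => (hrow i).le) ht0 htρ
  have hUB : IsUnit (1 - t • delSub A j).det := by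
    refine isUnit_det_one_sub_smul (delSub A j) (fun i k => hA _ _) (fun k => p k)
      (fun k => hp _) ρ t (fun i => ?_) ht0 htρ
    have h1 := hrow i
    rw [hsplit] at h1
    have h2 := mul_nonneg (hA i j) (hp j).le
    simp only [delSub, Matrix.submatrix_apply]
    linarith
  refine ⟨hUB, fun i hij => ?_⟩
  set R := (1 - t • A)⁻¹ with hR
  have hmul : (1 - t • A) * R = 1 := Matrix.mul_nonsing_inv _ hUA
  have hC : t⁻¹ • (1 : Matrix {i : Fin n // i ≠ j} {i : Fin n // i ≠ j} ℝ) - delSub A j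
      = t⁻¹ • (1 - t • delSub A j) := by
    rw [smul_sub, smul_smul, inv_mul_cancel₀ ht0.ne', one_smul]
  have hUC : IsUnit (t⁻¹ • (1 : Matrix {i : Fin n // i ≠ j} {i : Fin n // i ≠ j} ℝ)
      - delSub A j).det := by
    rw [hC, Matrix.det_smul]
    exact (IsUnit.pow _ (isUnit_iff_ne_zero.mpr (inv_ne_zero ht0.ne'))).mul hUB
  have hx : (t⁻¹ • (1 : Matrix {i : Fin n // i ≠ j} {i : Fin n // i ≠ j} ℝ)
      - delSub A j).mulVec (fun k => R k j) = R j j • delCol A j := by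
    funext k
    have h1 := congrFun (congrFun hmul k) j
    rw [Matrix.sub_mul, Matrix.one_mul, Matrix.smul_mul, Matrix.sub_apply, Matrix.smul_apply,
      Matrix.mul_apply, hsplit, Matrix.one_apply_ne k.2, smul_eq_mul] at h1
    rw [Matrix.sub_mulVec, Matrix.smul_mulVec, Matrix.one_mulVec]
    simp only [Pi.sub_apply, Pi.smul_apply, smul_eq_mul, Matrix.mulVec, dotProduct, delSub,
      Matrix.submatrix_apply, delCol]
    have h2 : t⁻¹ * R k j = A k j * R j j + ∑ l : {i : Fin n // i ≠ j}, A k l * R l j := by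
      rw [inv_mul_eq_iff_eq_mul₀ ht0.ne']
      linarith
    rw [h2]
    ring
  have h3 := congrArg (fun w => (t⁻¹ • (1 : Matrix {i : Fin n // i ≠ j} {i : Fin n // i ≠ j} ℝ)
      - delSub A j)⁻¹.mulVec w) hx
  simp only [Matrix.mulVec_mulVec] at h3
  rw [Matrix.nonsing_inv_mul _ hUC, Matrix.one_mulVec, Matrix.mulVec_smul] at h3
  simpa using congrFun h3 ⟨i, hij⟩
end

section
/- Let A be an n×n real symmetric matrix (n > 1) with nonnegative entries that is irreducible, ρ its Perron root, and 0 < t < ρ^{-1}. Then for all indices i ≠ j, the walk distance satisfies d_t(i,j) = −(1/2) · ln( ( (t^{-1} I − A_ĵĵ)^{-1} a_ĵj )_i · ( (t^{-1} I − A_îî)^{-1} a_îi )_j ), where A_ĵĵ is A with row j and column j deleted and a_ĵj is the j-th column of A with its j-th entry deleted (and symmetrically for i). -/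
open Matrix

theorem wd_posDef {n : ℕ} (A : Matrix (Fin n) (Fin n) ℝ) (hsym : A.IsSymm) (ρ : ℝ) (hρ : 0 < ρ)
    (hspec : ∀ (μ : ℝ) (v : Fin n → ℝ), v ≠ 0 → A.mulVec v = μ • v → |μ| ≤ ρ)
    (t : ℝ) (ht0 : 0 < t) (ht1 : t < ρ⁻¹) : (1 - t • A).PosDef := by
  have hh : (1 - t • A).IsHermitian := by
    have hA : A.IsHermitian := by
      rw [Matrix.IsHermitian, Matrix.conjTranspose_eq_transpose_of_trivial]; exact hsym
    rw [Matrix.IsHermitian, Matrix.conjTranspose_sub, Matrix.conjTranspose_smul, hA.eq]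
    simp
  rw [hh.posDef_iff_eigenvalues_pos]
  intro i
  have h := hh.mulVec_eigenvectorBasis i
  have hv : (⇑(hh.eigenvectorBasis i) : Fin n → ℝ) ≠ 0 := by
    intro h0
    have h1 := hh.eigenvectorBasis.orthonormal.ne_zero i
    apply h1
    ext k
    exact congrFun h0 k
  have h2 := hspec ((1 - hh.eigenvalues i) / t) _ hv (by
    ext k
    have hk := congrFun h k
    rw [Matrix.sub_mulVec, Matrix.one_mulVec, Matrix.smul_mulVec] at hk
    simp only [Pi.sub_apply, Pi.smul_apply, smul_eq_mul] at hk ⊢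
    field_simp
    linarith)
  have h3 := (abs_le.1 h2).2
  rw [div_le_iff₀ ht0] at h3
  have h4 : ρ * t < 1 := by
    have := mul_lt_mul_of_pos_left ht1 hρ
    rwa [mul_inv_cancel₀ hρ.ne'] at this
  linarith

theorem wd_col {n : ℕ} (A : Matrix (Fin n) (Fin n) ℝ) (t : ℝ) (ht0 : 0 < t)
    (hB : (1 - t • A).PosDef) (j i : Fin n) (hij : i ≠ j) :
    ((t⁻¹ • (1 : Matrix {k : Fin n // k ≠ j} {k : Fin n // k ≠ j} ℝ)
      - delSub A j)⁻¹.mulVec (delCol A j)) ⟨i, hij⟩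
      = (1 - t • A)⁻¹ i j / (1 - t • A)⁻¹ j j := by
  have hr : 0 < (1 - t • A)⁻¹ j j := hB.inv.diag_pos
  have hS : ((1 - t • A).submatrix (Subtype.val : {k : Fin n // k ≠ j} → Fin n)
      Subtype.val).PosDef := hB.submatrix Subtype.val_injective
  set R := (1 - t • A)⁻¹ with hR
  have hBR : (1 - t • A) * R = 1 := Matrix.mul_nonsing_inv _ ((Matrix.isUnit_iff_isUnit_det _).1 hB.isUnit)
  have hM : t⁻¹ • (1 : Matrix {k : Fin n // k ≠ j} {k : Fin n // k ≠ j} ℝ) - delSub A j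
      = t⁻¹ • ((1 - t • A).submatrix (Subtype.val : {k : Fin n // k ≠ j} → Fin n)
      Subtype.val) := by
    ext a b
    simp only [delSub, Matrix.sub_apply, Matrix.smul_apply, Matrix.submatrix_apply, smul_eq_mul,
      Matrix.one_apply, Subtype.ext_iff]
    field_simp
  have hU : IsUnit (t⁻¹ • (1 : Matrix {k : Fin n // k ≠ j} {k : Fin n // k ≠ j} ℝ)
      - delSub A j).det := by
    rw [hM, Matrix.det_smul]
    exact (isUnit_iff_ne_zero.2 (by positivity)).mul ((Matrix.isUnit_iff_isUnit_det _).1 hS.isUnit)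
  have key : (t⁻¹ • (1 : Matrix {k : Fin n // k ≠ j} {k : Fin n // k ≠ j} ℝ)
      - delSub A j).mulVec (fun k => R k j / R j j) = delCol A j := by
    ext a
    have h1 := congrFun (congrFun hBR a) j
    rw [Matrix.sub_mul, Matrix.one_mul, Matrix.smul_mul, Matrix.one_apply_ne a.2] at h1
    simp only [Matrix.sub_apply, Matrix.smul_apply, smul_eq_mul, Matrix.mul_apply] at h1
    rw [← Fintype.sum_subtype_add_sum_subtype (fun k => k ≠ j)] at h1
    have h2 : ∑ k : {k : Fin n // ¬ k ≠ j}, A a k * R k j = A a j * R j j := by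
      rw [Fintype.sum_eq_single (⟨j, by simp⟩ : {k : Fin n // ¬ k ≠ j})]
      rintro ⟨b, hb⟩ hne
      exact absurd (Subtype.ext (not_not.1 hb)) hne
    rw [h2] at h1
    rw [Matrix.sub_mulVec, Matrix.smul_mulVec, Matrix.one_mulVec]
    simp only [Pi.sub_apply, Pi.smul_apply, smul_eq_mul, Matrix.mulVec, dotProduct, delSub, delCol,
      Matrix.submatrix_apply, mul_div_assoc', ← Finset.sum_div]
    field_simp
    linarith
  rw [← key, Matrix.mulVec_mulVec, Matrix.nonsing_inv_mul _ hU, Matrix.one_mulVec]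

/-- for `i ≠ j`,
`d_t(i,j) = -(1/2) ln( ((t⁻¹I - A_ĵĵ)⁻¹ a_ĵj)_i · ((t⁻¹I - A_îî)⁻¹ a_îi)_j )`. -/
theorem walk_distance_block_expression
    {n : ℕ} (hn : 1 < n) (A : Matrix (Fin n) (Fin n) ℝ)
    (hsym : A.IsSymm) (hA : ∀ i j, 0 ≤ A i j)
    (hirr : ∀ i j : Fin n, i ≠ j → ∃ k : ℕ, 1 ≤ k ∧ 0 < (A ^ k) i j)
    (ρ : ℝ) (hρ : 0 < ρ) (p : Fin n → ℝ) (hp : ∀ i, 0 < p i)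
    (hAp : A.mulVec p = ρ • p)
    (hspec : ∀ (μ : ℝ) (v : Fin n → ℝ), v ≠ 0 → A.mulVec v = μ • v → |μ| ≤ ρ)
    (t : ℝ) (ht0 : 0 < t) (ht1 : t < ρ⁻¹)
    (d : Fin n → Fin n → ℝ)
    (hd : ∀ i j, d i j =
      -Real.log ((1 - t • A)⁻¹ i j /
        Real.sqrt ((1 - t • A)⁻¹ i i * (1 - t • A)⁻¹ j j))) :
    ∀ i j : Fin n, ∀ hij : i ≠ j,
      d i j =
        -(1 / 2) * Real.log
          (((t⁻¹ • (1 : Matrix {k : Fin n // k ≠ j} {k : Fin n // k ≠ j} ℝ)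
              - delSub A j)⁻¹.mulVec (delCol A j)) ⟨i, hij⟩ *
           ((t⁻¹ • (1 : Matrix {k : Fin n // k ≠ i} {k : Fin n // k ≠ i} ℝ)
              - delSub A i)⁻¹.mulVec (delCol A i)) ⟨j, hij.symm⟩) := by
  intro i j hij
  have hB := wd_posDef A hsym ρ hρ hspec t ht0 ht1
  rw [wd_col A t ht0 hB j i hij, wd_col A t ht0 hB i j hij.symm, hd]
  have hi : 0 < (1 - t • A)⁻¹ i i := hB.inv.diag_pos
  have hj : 0 < (1 - t • A)⁻¹ j j := hB.inv.diag_pos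
  have hs : (1 - t • A)⁻¹ j i = (1 - t • A)⁻¹ i j := by
    simpa using hB.inv.isHermitian.apply i j
  rw [hs]
  have e : (1 - t • A)⁻¹ i j / (1 - t • A)⁻¹ j j * ((1 - t • A)⁻¹ i j / (1 - t • A)⁻¹ i i)
      = ((1 - t • A)⁻¹ i j / Real.sqrt ((1 - t • A)⁻¹ i i * (1 - t • A)⁻¹ j j)) ^ 2 := by
    rw [div_pow, Real.sq_sqrt (by positivity)]
    field_simp
  rw [e, Real.log_pow]
  push_cast
  ring
end

section
/- Let A be an n×n real symmetric matrix (n > 1) with nonnegative entries that is irreducible and ρ its Perron root. For α > 0 put t(α) = (ρ + α^{-1})^{-1} and θ(α) = ln(e + α^{2/n}) · (α − 1)/ln α (with θ(1) = ln(e+1)). Then for all indices i ≠ j, the scaled walk distance d_α^W(i,j) = θ(α) · d_{t(α)}(i,j) converges, as α → 0+, to the shortest path distance d^s(i,j) = min{ k ≥ 1 : (A^k)_{ij} > 0 } between i and j in G. -/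
open Matrix Filter Topology

/-- The resolvent tends to the identity matrix as `t → 0`. -/
lemma resolvent_tendsto {n : ℕ} (A : Matrix (Fin n) (Fin n) ℝ) :
    (∀ᶠ t : ℝ in 𝓝 0, (1 - t • A).det ≠ 0) ∧
    Tendsto (fun t : ℝ => (1 - t • A)⁻¹) (𝓝 0) (𝓝 1) := by
  have hc : Continuous (fun t : ℝ => (1 - t • A)) := by fun_prop
  have hdet : Continuous (fun t : ℝ => (1 - t • A).det) := hc.matrix_det
  have hadj : Continuous (fun t : ℝ => (1 - t • A).adjugate) := hc.matrix_adjugate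
  have h0 : (1 - (0 : ℝ) • A).det ≠ 0 := by simp
  refine ⟨hdet.continuousAt.eventually_ne h0, ?_⟩
  have h1 : ContinuousAt (fun t : ℝ => ((1 - t • A).det)⁻¹ • (1 - t • A).adjugate) 0 :=
    (hdet.continuousAt.inv₀ h0).smul hadj.continuousAt
  have h2 := h1.tendsto
  simp only [zero_smul, sub_zero, det_one, inv_one, adjugate_one, one_smul] at h2
  refine h2.congr (fun t => ?_)
  rw [Matrix.inv_def, Ring.inverse_eq_inv']

/-- Finite expansion of the resolvent. -/
lemma resolvent_expand {n : ℕ} (A : Matrix (Fin n) (Fin n) ℝ) (t : ℝ)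
    (h : (1 - t • A).det ≠ 0) (m : ℕ) :
    (1 - t • A)⁻¹ = ∑ k ∈ Finset.range m, t ^ k • A ^ k + t ^ m • (A ^ m * (1 - t • A)⁻¹) := by
  have hmul : (1 - t • A) * (1 - t • A)⁻¹ = 1 :=
    Matrix.mul_nonsing_inv _ (isUnit_iff_ne_zero.mpr h)
  have hR : (1 - t • A)⁻¹ = 1 + t • (A * (1 - t • A)⁻¹) := by
    rw [sub_mul, one_mul, smul_mul_assoc] at hmul
    exact eq_add_of_sub_eq hmul
  induction m with
  | zero => simp
  | succ m ih =>
    rw [Finset.sum_range_succ, add_assoc]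
    have : t ^ m • (A ^ m * (1 - t • A)⁻¹)
        = t ^ m • A ^ m + t ^ (m + 1) • (A ^ (m + 1) * (1 - t • A)⁻¹) := by
      conv_lhs => rw [hR]
      rw [mul_add, mul_one, smul_add, mul_smul_comm, smul_smul, ← mul_assoc, pow_succ, pow_succ]
    rw [← this]
    exact ih

/-- the short walk distance. As `α → 0⁺`, the scaled walk distance
`θ(α) · d_{t(α)}(i,j)` tends to the shortest path distance
`d^s(i,j) = min { k ≥ 1 : (A^k)_{ij} > 0 }`. -/
theorem short_walk_distance_is_shortest_path
    {n : ℕ} (hn : 1 < n) (A : Matrix (Fin n) (Fin n) ℝ)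
    (hsym : A.IsSymm) (hA : ∀ i j, 0 ≤ A i j)
    (hirr : ∀ i j : Fin n, i ≠ j → ∃ k : ℕ, 1 ≤ k ∧ 0 < (A ^ k) i j)
    (ρ : ℝ) (hρ : 0 < ρ) (p : Fin n → ℝ) (hp : ∀ i, 0 < p i)
    (hAp : A.mulVec p = ρ • p)
    (hspec : ∀ (μ : ℝ) (v : Fin n → ℝ), v ≠ 0 → A.mulVec v = μ • v → |μ| ≤ ρ)
    (θ : ℝ → ℝ)
    (hθ : ∀ α : ℝ, α ≠ 1 →
      θ α = Real.log (Real.exp 1 + α ^ ((2 : ℝ) / (n : ℝ))) * (α - 1) / Real.log α)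
    (hθ1 : θ 1 = Real.log (Real.exp 1 + 1))
    (d : ℝ → Fin n → Fin n → ℝ)
    (hd : ∀ (t : ℝ) (i j : Fin n), d t i j =
      -Real.log ((1 - t • A)⁻¹ i j /
        Real.sqrt ((1 - t • A)⁻¹ i i * (1 - t • A)⁻¹ j j))) :
    ∀ i j : Fin n, i ≠ j →
      Tendsto (fun α : ℝ => θ α * d ((ρ + α⁻¹)⁻¹) i j) (𝓝[>] (0 : ℝ))
        (𝓝 ((sInf {k : ℕ | 1 ≤ k ∧ 0 < (A ^ k) i j} : ℕ) : ℝ)) := by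
  intro i j hij
  set m : ℕ := sInf {k : ℕ | 1 ≤ k ∧ 0 < (A ^ k) i j} with hm
  have hmem : m ∈ {k : ℕ | 1 ≤ k ∧ 0 < (A ^ k) i j} := Nat.sInf_mem (hirr i j hij)
  have hmpos : 0 < (A ^ m) i j := hmem.2
  have hnn : ∀ k : ℕ, ∀ a b, 0 ≤ (A ^ k) a b := by
    intro k
    induction k with
    | zero => intro a b; rw [pow_zero, Matrix.one_apply]; split_ifs <;> norm_num
    | succ k ih =>
      intro a b
      rw [pow_succ, Matrix.mul_apply]
      exact Finset.sum_nonneg fun c _ => mul_nonneg (ih a c) (hA c b)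
  have hz : ∀ k < m, (A ^ k) i j = 0 := by
    intro k hk
    rcases Nat.eq_zero_or_pos k with rfl | hk0
    · simp [hij]
    · have h1 := Nat.notMem_of_lt_sInf hk
      exact le_antisymm (not_lt.mp fun h => h1 ⟨hk0, h⟩) (hnn k i j)
  obtain ⟨hdet, hR⟩ := resolvent_tendsto A
  have hent : ∀ a b, Tendsto (fun t : ℝ => (1 - t • A)⁻¹ a b) (𝓝 0) (𝓝 ((1 : Matrix (Fin n) (Fin n) ℝ) a b)) :=
    fun a b => (tendsto_pi_nhds.mp ((tendsto_pi_nhds.mp hR) a)) b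
  have hAR : Tendsto (fun t : ℝ => (A ^ m * (1 - t • A)⁻¹) i j) (𝓝 0) (𝓝 ((A ^ m) i j)) := by
    have h1 : Tendsto (fun t : ℝ => A ^ m * (1 - t • A)⁻¹) (𝓝 0) (𝓝 (A ^ m * 1)) :=
      tendsto_const_nhds.mul hR
    rw [mul_one] at h1
    exact (tendsto_pi_nhds.mp ((tendsto_pi_nhds.mp h1) i)) j
  set g : ℝ → ℝ := fun t => (A ^ m * (1 - t • A)⁻¹) i j /
    Real.sqrt ((1 - t • A)⁻¹ i i * (1 - t • A)⁻¹ j j) with hg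
  have hgt : Tendsto g (𝓝 0) (𝓝 ((A ^ m) i j)) := by
    have h1 := ((hent i i).mul (hent j j)).sqrt
    have h2 := hAR.div h1 (by simp)
    simp only [Matrix.one_apply_eq, mul_one, Real.sqrt_one, div_one] at h2
    exact h2
  -- the parameter
  have hteq : ∀ α : ℝ, 0 < α → (ρ + α⁻¹)⁻¹ = α / (1 + ρ * α) := by
    intro α hα
    have : 0 < 1 + ρ * α := by positivity
    field_simp
    ring
  have hid : Tendsto (fun α : ℝ => α) (𝓝[>] (0 : ℝ)) (𝓝 0) := nhdsWithin_le_nhds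
  have hpos : ∀ᶠ α : ℝ in 𝓝[>] (0 : ℝ), 0 < α := self_mem_nhdsWithin
  have hden : Tendsto (fun α : ℝ => 1 + ρ * α) (𝓝[>] (0 : ℝ)) (𝓝 1) := by
    simpa using (hid.const_mul ρ).const_add 1
  have ht : Tendsto (fun α : ℝ => (ρ + α⁻¹)⁻¹) (𝓝[>] (0 : ℝ)) (𝓝 0) := by
    have h1 := hid.div hden one_ne_zero
    rw [zero_div] at h1
    refine h1.congr' ?_
    filter_upwards [hpos] with α hα
    simp [hteq α hα]
  have hlog : Tendsto (fun α : ℝ => (Real.log α)⁻¹) (𝓝[>] (0 : ℝ)) (𝓝 0) :=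
    Real.tendsto_log_nhdsGT_zero.inv_tendsto_atBot
  have hL : Tendsto (fun α : ℝ => Real.log (Real.exp 1 + α ^ ((2 : ℝ) / (n : ℝ))))
      (𝓝[>] (0 : ℝ)) (𝓝 1) := by
    have hq : (0 : ℝ) < 2 / n := by
      have : (0 : ℝ) < n := by exact_mod_cast (by omega : 0 < n)
      positivity
    have h1 := (hid.rpow_const (Or.inr hq.le) : Tendsto (fun α : ℝ => α ^ ((2 : ℝ) / (n : ℝ))) _ _)
    rw [Real.zero_rpow hq.ne'] at h1
    have h2 := (h1.const_add (Real.exp 1)).log (by positivity)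
    simpa using h2
  have hlogden : Tendsto (fun α : ℝ => Real.log (1 + ρ * α)) (𝓝[>] (0 : ℝ)) (𝓝 0) := by
    simpa using hden.log one_ne_zero
  have hlogg : Tendsto (fun α : ℝ => Real.log (g ((ρ + α⁻¹)⁻¹))) (𝓝[>] (0 : ℝ))
      (𝓝 (Real.log ((A ^ m) i j))) := (hgt.comp ht).log hmpos.ne'
  have hone : Tendsto (fun α : ℝ => 1 - α) (𝓝[>] (0 : ℝ)) (𝓝 1) := by
    simpa using hid.const_sub 1
  have hfin : Tendsto (fun α : ℝ => Real.log (Real.exp 1 + α ^ ((2 : ℝ) / (n : ℝ))) * (1 - α) *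
      ((m : ℝ) * (1 - Real.log (1 + ρ * α) * (Real.log α)⁻¹)
        + Real.log (g ((ρ + α⁻¹)⁻¹)) * (Real.log α)⁻¹)) (𝓝[>] (0 : ℝ)) (𝓝 (m : ℝ)) := by
    have h := (hL.mul hone).mul
      ((((hlogden.mul hlog).const_sub 1).const_mul (m : ℝ)).add (hlogg.mul hlog))
    simpa using h
  refine hfin.congr' ?_
  have hgpos : ∀ᶠ t : ℝ in 𝓝 0, 0 < g t := hgt.eventually (lt_mem_nhds hmpos)
  have hlt1 : ∀ᶠ α : ℝ in 𝓝[>] (0 : ℝ), α < 1 := hid.eventually (gt_mem_nhds one_pos)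
  filter_upwards [hpos, hlt1, ht.eventually hgpos, ht.eventually hdet] with α hα hα1 hgα hdα
  have hlα : Real.log α ≠ 0 := (Real.log_neg hα hα1).ne
  have hdp : 0 < 1 + ρ * α := by positivity
  have htpos : 0 < (ρ + α⁻¹)⁻¹ := by positivity
  have hlt : Real.log ((ρ + α⁻¹)⁻¹) = Real.log α - Real.log (1 + ρ * α) := by
    rw [hteq α hα, Real.log_div hα.ne' hdp.ne']
  have hRij : (1 - (ρ + α⁻¹)⁻¹ • A)⁻¹ i j
      = (ρ + α⁻¹)⁻¹ ^ m * (A ^ m * (1 - (ρ + α⁻¹)⁻¹ • A)⁻¹) i j := by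
    have h1 := congrFun (congrFun (resolvent_expand A _ hdα m) i) j
    rw [Matrix.add_apply, Matrix.sum_apply, Finset.sum_eq_zero, zero_add] at h1
    · simpa only [Matrix.smul_apply, smul_eq_mul] using h1
    · intro k hk
      rw [Matrix.smul_apply, hz k (Finset.mem_range.mp hk), smul_zero]
  have hdd : d ((ρ + α⁻¹)⁻¹) i j
      = -((m : ℝ) * (Real.log α - Real.log (1 + ρ * α)) + Real.log (g ((ρ + α⁻¹)⁻¹))) := by
    rw [hd, hRij, mul_div_assoc, Real.log_mul (by positivity) hgα.ne', Real.log_pow, hlt]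
  rw [hdd, hθ α hα1.ne]
  field_simp
  ring
end

section
/- Let A be an n×n real symmetric matrix (n > 1) with nonnegative entries that is irreducible, ρ its Perron root, and p a strictly positive eigenvector with A p = ρ p and ker(ρI − A) = span{p}. Then for all indices i and j, the hitting-walk weight r_{ij(1)}(t) = r_{ij}(t)/r_{jj}(t), where r_{ij}(t) are the entries of (I − tA)^{-1}, satisfies lim_{t → (ρ^{-1})^-} r_{ij}(t)/r_{jj}(t) = p_i / p_j; consequently lim_{t → (ρ^{-1})^-} ( r_{ij}(t)/r_{jj}(t) ) · ( r_{ji}(t)/r_{ii}(t) ) = 1. -/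
open Matrix Filter Topology

/-- `lim_{t → (ρ⁻¹)⁻} r_ij(t)/r_jj(t) = p_i/p_j`, and consequently
`lim_{t → (ρ⁻¹)⁻} (r_ij/r_jj)·(r_ji/r_ii) = 1`. -/
theorem limit_hitting_walk_weights
    {n : ℕ} (hn : 1 < n) (A : Matrix (Fin n) (Fin n) ℝ)
    (hsym : A.IsSymm) (hA : ∀ i j, 0 ≤ A i j)
    (hirr : ∀ i j : Fin n, i ≠ j → ∃ k : ℕ, 1 ≤ k ∧ 0 < (A ^ k) i j)
    (ρ : ℝ) (hρ : 0 < ρ) (p : Fin n → ℝ) (hp : ∀ i, 0 < p i)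
    (hAp : A.mulVec p = ρ • p)
    (hspec : ∀ (μ : ℝ) (v : Fin n → ℝ), v ≠ 0 → A.mulVec v = μ • v → |μ| ≤ ρ)
    (hker : ∀ v : Fin n → ℝ, A.mulVec v = ρ • v → ∃ c : ℝ, v = c • p) :
    ∀ i j : Fin n,
      Tendsto (fun t : ℝ => (1 - t • A)⁻¹ i j / (1 - t • A)⁻¹ j j)
        (𝓝[<] ρ⁻¹) (𝓝 (p i / p j)) ∧
      Tendsto (fun t : ℝ =>
          ((1 - t • A)⁻¹ i j / (1 - t • A)⁻¹ j j) *
          ((1 - t • A)⁻¹ j i / (1 - t • A)⁻¹ i i))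
        (𝓝[<] ρ⁻¹) (𝓝 1) := by
  classical
  set P : Matrix (Fin n) (Fin n) ℝ := vecMulVec p p with hP
  set s : ℝ := p ⬝ᵥ p with hs
  have hspos : 0 < s := by
    have : Nonempty (Fin n) := ⟨⟨0, by omega⟩⟩
    exact Finset.sum_pos (fun i _ => mul_pos (hp i) (hp i)) Finset.univ_nonempty
  have hpA : p ᵥ* A = ρ • p := by
    rw [← hAp, ← Matrix.vecMul_transpose, hsym.eq]
  have hAP : A * P = ρ • P := by
    rw [hP, Matrix.mul_vecMulVec, hAp, Matrix.smul_vecMulVec]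
  have hPA : P * A = ρ • P := by
    rw [hP, Matrix.vecMulVec_mul, hpA, Matrix.vecMulVec_smul]
  have hPP : P * P = s • P := by
    rw [hP, Matrix.vecMulVec_mul_vecMulVec, Matrix.vecMulVec_smul]
  let M : ℝ → Matrix (Fin n) (Fin n) ℝ := fun t => 1 - t • A + P
  have hMc : Continuous M := by
    apply Continuous.add _ continuous_const
    exact continuous_const.sub (continuous_id.smul continuous_const)
  have hPM : ∀ t, P * M t = (1 - t * ρ + s) • P := by
    intro t
    simp only [M, mul_add, mul_sub, mul_one, Matrix.mul_smul, hPA, hPP, smul_smul, add_smul,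
      sub_smul, one_smul]
  have hM0 : (M ρ⁻¹).det ≠ 0 := by
    intro h0
    obtain ⟨v, hv, hMv⟩ := Matrix.exists_mulVec_eq_zero_iff.mpr h0
    have h1 : P *ᵥ v = 0 := by
      have h2 : (P * M ρ⁻¹) *ᵥ v = 0 := by
        rw [← Matrix.mulVec_mulVec, hMv, Matrix.mulVec_zero]
      rw [hPM, inv_mul_cancel₀ hρ.ne', Matrix.smul_mulVec] at h2
      have : (1 - 1 + s : ℝ) ≠ 0 := by simpa using hspos.ne'
      exact (smul_eq_zero.mp h2).resolve_left this
    have h3 : A *ᵥ v = ρ • v := by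
      have h4 : v - ρ⁻¹ • (A *ᵥ v) = 0 := by
        simpa [M, Matrix.add_mulVec, Matrix.sub_mulVec, Matrix.smul_mulVec, h1] using hMv
      have h5 : v = ρ⁻¹ • (A *ᵥ v) := sub_eq_zero.mp h4
      have h6 := congrArg (fun w => ρ • w) h5
      simp only [smul_smul, mul_inv_cancel₀ hρ.ne', one_smul] at h6
      exact h6.symm
    obtain ⟨c, rfl⟩ := hker v h3
    have i0 : Fin n := ⟨0, by omega⟩
    have h7 := congrFun h1 i0
    have h8 : P *ᵥ (c • p) = (c * s) • p := by
      rw [Matrix.mulVec_smul, hP, Matrix.vecMulVec_mulVec]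
      ext i
      simp [hs]
      ring
    rw [h8] at h7
    simp only [Pi.smul_apply, smul_eq_mul, Pi.zero_apply, mul_eq_zero, hspos.ne', (hp i0).ne',
      or_false] at h7
    exact hv (by rw [h7, zero_smul])
  have hMinv : ∀ i j, Tendsto (fun t => (M t)⁻¹ i j) (𝓝[<] ρ⁻¹) (𝓝 ((M ρ⁻¹)⁻¹ i j)) := by
    intro i j
    have h1 : ContinuousAt (fun t => ((M t).det)⁻¹ * (M t).adjugate i j) ρ⁻¹ :=
      (hMc.matrix_det.continuousAt.inv₀ hM0).mul
        (hMc.matrix_adjugate.matrix_elem i j).continuousAt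
    have h2 : ∀ t, (M t)⁻¹ i j = ((M t).det)⁻¹ * (M t).adjugate i j := by
      intro t
      simp [Matrix.inv_def]
    simp only [h2]
    exact h1.tendsto.mono_left nhdsWithin_le_nhds
  have hdet : ∀ᶠ t in 𝓝[<] ρ⁻¹, (M t).det ≠ 0 :=
    (hMc.matrix_det.continuousAt.eventually_ne hM0).filter_mono nhdsWithin_le_nhds
  have hkey : ∀ᶠ t in 𝓝[<] ρ⁻¹, 0 < 1 - t * ρ ∧ ∀ i j, (1 - t • A)⁻¹ i j =
      (1 - t * ρ)⁻¹ * ((1 - t * ρ) * (M t)⁻¹ i j + (1 - t * ρ + s)⁻¹ * (p i * p j)) := by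
    filter_upwards [hdet, self_mem_nhdsWithin] with t ht htρ
    have he : 0 < 1 - t * ρ := by
      have := mul_lt_mul_of_pos_right (Set.mem_Iio.mp htρ) hρ
      rw [inv_mul_cancel₀ hρ.ne'] at this
      linarith
    have hm : 1 - t * ρ + s ≠ 0 := by positivity
    have hu : IsUnit (M t).det := isUnit_iff_ne_zero.mpr ht
    have hPi : P * (M t)⁻¹ = (1 - t * ρ + s)⁻¹ • P := by
      have h1 : (P * M t) * (M t)⁻¹ = P := Matrix.mul_nonsing_inv_cancel_right _ _ hu
      rw [hPM, Matrix.smul_mul] at h1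
      rw [← h1, smul_smul, inv_mul_cancel₀ hm, one_smul, h1]
    have hB : 1 - t • A = M t - P := by simp [M]
    have hBP : (1 - t • A) * P = (1 - t * ρ) • P := by
      rw [sub_mul, one_mul, Matrix.smul_mul, hAP, smul_smul, sub_smul, one_smul]
    have hinv : (1 - t • A)⁻¹ =
        (M t)⁻¹ + ((1 - t * ρ)⁻¹ * (1 - t * ρ + s)⁻¹) • P := by
      apply Matrix.inv_eq_right_inv
      rw [mul_add, Matrix.mul_smul, hBP, hB, sub_mul, Matrix.mul_nonsing_inv _ hu, hPi, smul_smul]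
      have : (1 - t * ρ)⁻¹ * (1 - t * ρ + s)⁻¹ * (1 - t * ρ) = (1 - t * ρ + s)⁻¹ := by
        field_simp
      rw [this, sub_add_cancel]
    refine ⟨he, fun i j => ?_⟩
    rw [hinv]
    simp only [Matrix.add_apply, Matrix.smul_apply, hP, Matrix.vecMulVec_apply, smul_eq_mul]
    have := he.ne'
    rw [mul_add, inv_mul_cancel_left₀ this, mul_assoc]
  have hte : Tendsto (fun t : ℝ => 1 - t * ρ) (𝓝[<] ρ⁻¹) (𝓝 0) := by
    have h : ContinuousAt (fun t : ℝ => 1 - t * ρ) ρ⁻¹ := by fun_prop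
    have h' := h.tendsto
    rw [inv_mul_cancel₀ hρ.ne', sub_self] at h'
    exact h'.mono_left nhdsWithin_le_nhds
  have hnum : ∀ i j, Tendsto (fun t : ℝ => (1 - t * ρ) * (M t)⁻¹ i j +
      (1 - t * ρ + s)⁻¹ * (p i * p j)) (𝓝[<] ρ⁻¹) (𝓝 (s⁻¹ * (p i * p j))) := by
    intro i j
    have h1 := hte.mul (hMinv i j)
    have h2 : Tendsto (fun t : ℝ => (1 - t * ρ + s)⁻¹) (𝓝[<] ρ⁻¹) (𝓝 s⁻¹) := by
      have h3 := hte.add_const s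
      rw [zero_add] at h3
      exact h3.inv₀ hspos.ne'
    have h4 := h1.add (h2.mul_const (p i * p j))
    rwa [zero_mul, zero_add] at h4
  have hmain : ∀ i j, Tendsto (fun t : ℝ => (1 - t • A)⁻¹ i j / (1 - t • A)⁻¹ j j)
        (𝓝[<] ρ⁻¹) (𝓝 (p i / p j)) := by
    intro i j
    have hj := (hp j).ne'
    have h1 := (hnum i j).div (hnum j j)
      (mul_ne_zero (inv_ne_zero hspos.ne') (mul_ne_zero hj hj))
    have h2 : s⁻¹ * (p i * p j) / (s⁻¹ * (p j * p j)) = p i / p j := by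
      have := hspos.ne'
      field_simp
    rw [h2] at h1
    refine h1.congr' ?_
    filter_upwards [hkey] with t ht
    rw [ht.2 i j, ht.2 j j, mul_div_mul_left _ _ (inv_ne_zero ht.1.ne')]
    rfl
  intro i j
  refine ⟨hmain i j, ?_⟩
  have h := (hmain i j).mul (hmain j i)
  have h1 : p i / p j * (p j / p i) = 1 := by
    have := (hp i).ne'
    have := (hp j).ne'
    field_simp
  rwa [h1] at h
end

section
/- Let A be an n×n real symmetric matrix (n > 1) with nonnegative entries that is irreducible, ρ its Perron root, and p a strictly positive eigenvector with A p = ρ p and ker(ρI − A) = span{p}. For α > 0 put t(α) = (ρ + α^{-1})^{-1} and θ(α) = ln(e + α^{2/n}) · (α − 1)/ln α. Then for all indices i ≠ j, the long walk distance d^LW(i,j) = lim_{α → ∞} θ(α) · d_{t(α)}(i,j) exists and equals n^{-1} · ( p_i^{-1} · ( (ρI − A_ĵĵ)^{-1} p_ĵ )_i + p_j^{-1} · ( (ρI − A_îî)^{-1} p_î )_j ). -/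
open Matrix Filter Topology

/-- `p` with its `j`-th entry deleted. -/
noncomputable def delVec {n : ℕ} (p : Fin n → ℝ) (j : Fin n) :
    {i : Fin n // i ≠ j} → ℝ :=
  fun k => p k

/-- Extension by zero turns `delSub` products into full products. -/
lemma lw_sum_del {n : ℕ} (j : Fin n) (g : Fin n → ℝ) :
    ∑ l, g l = g j + ∑ l : {k : Fin n // k ≠ j}, g l := by
  rw [← Fintype.sum_subtype_add_sum_subtype (fun k => k = j) g]
  congr 1
  simp
  rfl

lemma lw_mulVec {n : ℕ} (A : Matrix (Fin n) (Fin n) ℝ) (j : Fin n) (l : ℝ) (v : Fin n → ℝ)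
    (k : {k : Fin n // k ≠ j}) :
    ((l • (1 : Matrix {k : Fin n // k ≠ j} {k : Fin n // k ≠ j} ℝ)
      - delSub A j).mulVec (delVec v j)) k
      = l * v k - (A.mulVec v) k + A k j * v j := by
  have h := lw_sum_del j (fun m => A k m * v m)
  have h2 : ((delSub A j).mulVec (delVec v j)) k
      = ∑ m : {k : Fin n // k ≠ j}, A k m * v m := rfl
  have h3 : (A.mulVec v) k = ∑ m, A k m * v m := rfl
  rw [Matrix.sub_mulVec, Matrix.smul_mulVec, Matrix.one_mulVec, Pi.sub_apply, h2, h3, h]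
  simp only [Pi.smul_apply, smul_eq_mul, delVec]
  ring

lemma lw_key {n : ℕ} (A : Matrix (Fin n) (Fin n) ℝ) (p v : Fin n → ℝ) (ρ l : ℝ)
    (hAp : A.mulVec p = ρ • p) (i j : Fin n) (hij : i ≠ j)
    (hv : ∀ k, k ≠ j → l * v k - (A.mulVec v) k = 0)
    (hdet : (l • (1 : Matrix {k : Fin n // k ≠ j} {k : Fin n // k ≠ j} ℝ)
      - delSub A j).det ≠ 0) :
    v i * p j = v j * (p i - (l - ρ) *
      ((l • (1 : Matrix {k : Fin n // k ≠ j} {k : Fin n // k ≠ j} ℝ)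
      - delSub A j)⁻¹.mulVec (delVec p j)) ⟨i, hij⟩) := by
  set D := (l • (1 : Matrix {k : Fin n // k ≠ j} {k : Fin n // k ≠ j} ℝ)
      - delSub A j) with hD
  set g := D⁻¹.mulVec (delVec p j) with hg
  have hDg : D.mulVec g = delVec p j := by
    rw [hg, Matrix.mulVec_mulVec, Matrix.mul_nonsing_inv _ (isUnit_iff_ne_zero.2 hdet),
      Matrix.one_mulVec]
  have hz : p j • delVec v j - v j • delVec p j + (v j * (l - ρ)) • g = 0 := by
    apply Matrix.eq_zero_of_mulVec_eq_zero hdet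
    rw [Matrix.mulVec_add, Matrix.mulVec_sub, Matrix.mulVec_smul, Matrix.mulVec_smul,
      Matrix.mulVec_smul, hDg]
    ext k
    simp only [Pi.add_apply, Pi.sub_apply, Pi.smul_apply, smul_eq_mul, Pi.zero_apply]
    rw [hD, lw_mulVec, lw_mulVec, hv k k.2, hAp]
    simp only [Pi.smul_apply, smul_eq_mul, delVec]
    ring
  have := congrFun hz ⟨i, hij⟩
  simp only [Pi.add_apply, Pi.sub_apply, Pi.smul_apply, smul_eq_mul, Pi.zero_apply, delVec] at this
  linarith

lemma lw_det0 {n : ℕ} (A : Matrix (Fin n) (Fin n) ℝ) (hsym : A.IsSymm)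
    (p : Fin n → ℝ) (ρ : ℝ) (hp : ∀ i, 0 < p i)
    (hAp : A.mulVec p = ρ • p)
    (hker : ∀ v : Fin n → ℝ, A.mulVec v = ρ • v → ∃ c : ℝ, v = c • p) (j : Fin n) :
    (ρ • (1 : Matrix {k : Fin n // k ≠ j} {k : Fin n // k ≠ j} ℝ)
      - delSub A j).det ≠ 0 := by
  intro h
  obtain ⟨x, hx, hx0⟩ := Matrix.exists_mulVec_eq_zero_iff.2 h
  let y : Fin n → ℝ := fun k => if h : k ≠ j then x ⟨k, h⟩ else 0
  have hyj : y j = 0 := by simp [y]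
  have hyx : delVec y j = x := by
    ext k
    simp [y, delVec, k.2]
  have h1 : ∀ k, k ≠ j → ρ * y k - (A.mulVec y) k = 0 := by
    intro k hk
    have := lw_mulVec A j ρ y ⟨k, hk⟩
    rw [hyx, hx0, hyj] at this
    simp at this
    linarith
  have h2 : p ⬝ᵥ (A.mulVec y) = ρ * (p ⬝ᵥ y) := by
    rw [Matrix.dotProduct_mulVec, ← Matrix.mulVec_transpose, hsym, hAp, smul_dotProduct, smul_eq_mul]
  have h3 : ∑ k, p k * (ρ * y k - (A.mulVec y) k) = 0 := by
    simp only [dotProduct] at h2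
    simp only [mul_sub, Finset.sum_sub_distrib]
    rw [h2, Finset.mul_sum, sub_eq_zero]
    apply Finset.sum_congr rfl
    intros; ring
  rw [Finset.sum_eq_single j (fun k _ hk => by rw [h1 k hk, mul_zero]) (by simp)] at h3
  have h4 := (mul_eq_zero.1 h3).resolve_left (hp j).ne'
  obtain ⟨c, hc⟩ := hker y (by
    ext k
    simp only [Pi.smul_apply, smul_eq_mul]
    by_cases hk : k = j
    · rw [hk]; linarith
    · linarith [h1 k hk])
  have hc0 : c = 0 := by
    have := congrFun hc j
    rw [hyj] at this
    simp only [Pi.smul_apply, smul_eq_mul] at this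
    exact (mul_eq_zero.1 this.symm).resolve_right (hp j).ne'
  apply hx
  rw [← hyx, hc, hc0]
  ext k
  simp [delVec]

lemma lw_theta (n : ℕ) (hn : 1 < n) (θ : ℝ → ℝ)
    (hθ : ∀ α : ℝ, α ≠ 1 →
      θ α = Real.log (Real.exp 1 + α ^ ((2 : ℝ) / (n : ℝ))) * (α - 1) / Real.log α) :
    Tendsto (fun α => θ α * α⁻¹) atTop (𝓝 (2 / n)) := by
  have hc : (0 : ℝ) < 2 / n := by positivity
  set c : ℝ := 2 / n with hcd
  have a1 : Tendsto (fun α : ℝ => α ^ (-c)) atTop (𝓝 0) := tendsto_rpow_neg_atTop hc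
  have a2 : Tendsto (fun α : ℝ => Real.log (1 + Real.exp 1 * α ^ (-c))) atTop (𝓝 (Real.log (1 + Real.exp 1 * 0))) := by
    apply Tendsto.log
    · exact tendsto_const_nhds.add (tendsto_const_nhds.mul a1)
    · simp
  have a3 : Tendsto (fun α : ℝ => (Real.log α)⁻¹) atTop (𝓝 0) :=
    tendsto_inv_atTop_zero.comp Real.tendsto_log_atTop
  have a4 : Tendsto (fun α : ℝ => α⁻¹) atTop (𝓝 0) := tendsto_inv_atTop_zero
  have a5 : Tendsto (fun α : ℝ => (c + Real.log (1 + Real.exp 1 * α ^ (-c)) * (Real.log α)⁻¹) * (1 - α⁻¹)) atTop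
      (𝓝 ((c + Real.log (1 + Real.exp 1 * 0) * 0) * (1 - 0))) :=
    (tendsto_const_nhds.add (a2.mul a3)).mul (tendsto_const_nhds.sub a4)
  have e : (c + Real.log (1 + Real.exp 1 * 0) * 0) * (1 - 0) = c := by ring
  rw [e] at a5
  refine a5.congr' ?_
  filter_upwards [eventually_gt_atTop 1] with α hα
  have h0 : (0 : ℝ) < α := by linarith
  have hl : 0 < Real.log α := Real.log_pos hα
  have hpw : 0 < α ^ c := Real.rpow_pos_of_pos h0 c
  rw [hθ α hα.ne']
  have : Real.exp 1 + α ^ c = α ^ c * (1 + Real.exp 1 * α ^ (-c)) := by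
    rw [Real.rpow_neg h0.le]; field_simp; ring
  rw [this, Real.log_mul hpw.ne' (by positivity), Real.log_rpow h0]
  field_simp

/-- The shifted deleted matrix. -/
noncomputable def lwF {n : ℕ} (A : Matrix (Fin n) (Fin n) ℝ) (p : Fin n → ℝ) (i j : Fin n)
    (hij : i ≠ j) (l : ℝ) : ℝ :=
  ((l • (1 : Matrix {k : Fin n // k ≠ j} {k : Fin n // k ≠ j} ℝ)
      - delSub A j)⁻¹.mulVec (delVec p j)) ⟨i, hij⟩

lemma lw_cont_mat {n : ℕ} (A : Matrix (Fin n) (Fin n) ℝ) (j : Fin n) :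
    Continuous (fun l : ℝ => (l • (1 : Matrix {k : Fin n // k ≠ j} {k : Fin n // k ≠ j} ℝ)
      - delSub A j)) := by fun_prop

lemma lw_cont {n : ℕ} (A : Matrix (Fin n) (Fin n) ℝ) (p : Fin n → ℝ) (i j : Fin n)
    (hij : i ≠ j) (ρ : ℝ)
    (hdet : (ρ • (1 : Matrix {k : Fin n // k ≠ j} {k : Fin n // k ≠ j} ℝ)
      - delSub A j).det ≠ 0) : ContinuousAt (lwF A p i j hij) ρ := by
  have hm := lw_cont_mat A j
  have h1 : lwF A p i j hij = fun l : ℝ => ((l • (1 : Matrix {k : Fin n // k ≠ j} {k : Fin n // k ≠ j} ℝ)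
      - delSub A j).det)⁻¹ * (((l • (1 : Matrix {k : Fin n // k ≠ j} {k : Fin n // k ≠ j} ℝ)
      - delSub A j).adjugate.mulVec (delVec p j)) ⟨i, hij⟩) := by
    funext l
    rw [lwF, Matrix.inv_def, Matrix.smul_mulVec, Ring.inverse_eq_inv']
    rfl
  rw [h1]
  apply ContinuousAt.mul
  · exact (hm.matrix_det.continuousAt).inv₀ hdet
  · exact ((continuous_apply _).comp
      (hm.matrix_adjugate.matrix_mulVec continuous_const)).continuousAt

lemma lw_logsqrt (x y a : ℝ) (hxy : x ^ 2 = y * a) (ha : 0 < a) (hx : x ≠ 0) :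
    Real.log (x / Real.sqrt y) = 1 / 2 * Real.log a := by
  have hx2 : 0 < x ^ 2 := by positivity
  have hy : 0 < y := by
    by_contra h
    push Not at h
    nlinarith [mul_nonneg (neg_nonneg.2 h) ha.le]
  have h1 : Real.log (x ^ 2) = Real.log y + Real.log a := by
    rw [hxy, Real.log_mul hy.ne' ha.ne']
  rw [Real.log_pow] at h1
  push_cast at h1
  rw [Real.log_div hx (Real.sqrt_pos.2 hy).ne', Real.log_sqrt hy.le]
  linarith

/-- the long walk distance. For `i ≠ j`,
`lim_{α → ∞} θ(α) d_{t(α)}(i,j) = n⁻¹ ( p_i⁻¹ ((ρI - A_ĵĵ)⁻¹ p_ĵ)_i + p_j⁻¹ ((ρI - A_îî)⁻¹ p_î)_j )`. -/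
theorem long_walk_distance_formula
    {n : ℕ} (hn : 1 < n) (A : Matrix (Fin n) (Fin n) ℝ)
    (hsym : A.IsSymm) (hA : ∀ i j, 0 ≤ A i j)
    (hirr : ∀ i j : Fin n, i ≠ j → ∃ k : ℕ, 1 ≤ k ∧ 0 < (A ^ k) i j)
    (ρ : ℝ) (hρ : 0 < ρ) (p : Fin n → ℝ) (hp : ∀ i, 0 < p i)
    (hAp : A.mulVec p = ρ • p)
    (hspec : ∀ (μ : ℝ) (v : Fin n → ℝ), v ≠ 0 → A.mulVec v = μ • v → |μ| ≤ ρ)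
    (hker : ∀ v : Fin n → ℝ, A.mulVec v = ρ • v → ∃ c : ℝ, v = c • p)
    (θ : ℝ → ℝ)
    (hθ : ∀ α : ℝ, α ≠ 1 →
      θ α = Real.log (Real.exp 1 + α ^ ((2 : ℝ) / (n : ℝ))) * (α - 1) / Real.log α)
    (hθ1 : θ 1 = Real.log (Real.exp 1 + 1))
    (d : ℝ → Fin n → Fin n → ℝ)
    (hd : ∀ (t : ℝ) (i j : Fin n), d t i j =
      -Real.log ((1 - t • A)⁻¹ i j /
        Real.sqrt ((1 - t • A)⁻¹ i i * (1 - t • A)⁻¹ j j))) :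
    ∀ i j : Fin n, ∀ hij : i ≠ j,
      Tendsto (fun α : ℝ => θ α * d ((ρ + α⁻¹)⁻¹) i j) atTop
        (𝓝 ((n : ℝ)⁻¹ *
          ((p i)⁻¹ *
            ((ρ • (1 : Matrix {k : Fin n // k ≠ j} {k : Fin n // k ≠ j} ℝ)
              - delSub A j)⁻¹.mulVec (delVec p j)) ⟨i, hij⟩ +
           (p j)⁻¹ *
            ((ρ • (1 : Matrix {k : Fin n // k ≠ i} {k : Fin n // k ≠ i} ℝ)
              - delSub A i)⁻¹.mulVec (delVec p i)) ⟨j, hij.symm⟩))) := by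
  intro i j hij
  have hdj := lw_det0 A hsym p ρ hp hAp hker j
  have hdi := lw_det0 A hsym p ρ hp hAp hker i
  have hlim : Tendsto (fun α : ℝ => ρ + α⁻¹) atTop (𝓝 ρ) := by
    simpa using (tendsto_const_nhds (x := ρ)).add (tendsto_inv_atTop_zero (𝕜 := ℝ))
  have hF1 : Tendsto (fun α : ℝ => lwF A p i j hij (ρ + α⁻¹)) atTop (𝓝 (lwF A p i j hij ρ)) :=
    (lw_cont A p i j hij ρ hdj).tendsto.comp hlim
  have hF2 : Tendsto (fun α : ℝ => lwF A p j i hij.symm (ρ + α⁻¹)) atTop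
      (𝓝 (lwF A p j i hij.symm ρ)) :=
    (lw_cont A p j i hij.symm ρ hdi).tendsto.comp hlim
  have hdets : ∀ j, ∀ᶠ α : ℝ in atTop,
      ((ρ + α⁻¹) • (1 : Matrix {k : Fin n // k ≠ j} {k : Fin n // k ≠ j} ℝ)
      - delSub A j).det ≠ 0 := fun j =>
    ((lw_cont_mat A j).matrix_det.continuousAt.tendsto.comp hlim).eventually_ne
      (lw_det0 A hsym p ρ hp hAp hker j)
  -- the two factors
  set u : ℝ → ℝ := fun α => -(α⁻¹ * ((p i)⁻¹ * lwF A p i j hij (ρ + α⁻¹))) with hu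
  set w : ℝ → ℝ := fun α => -(α⁻¹ * ((p j)⁻¹ * lwF A p j i hij.symm (ρ + α⁻¹))) with hw
  have hu0 : Tendsto u atTop (𝓝 0) := by
    simpa using ((tendsto_inv_atTop_zero (𝕜 := ℝ)).mul (hF1.const_mul (p i)⁻¹)).neg
  have hw0 : Tendsto w atTop (𝓝 0) := by
    simpa using ((tendsto_inv_atTop_zero (𝕜 := ℝ)).mul (hF2.const_mul (p j)⁻¹)).neg
  have hu1 : Tendsto (fun α => α * u α) atTop (𝓝 (-((p i)⁻¹ * lwF A p i j hij ρ))) := by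
    refine (hF1.const_mul (p i)⁻¹).neg.congr' ?_
    filter_upwards [eventually_gt_atTop 0] with α hα
    simp only [hu]; field_simp
  have hw1 : Tendsto (fun α => α * w α) atTop (𝓝 (-((p j)⁻¹ * lwF A p j i hij.symm ρ))) := by
    refine (hF2.const_mul (p j)⁻¹).neg.congr' ?_
    filter_upwards [eventually_gt_atTop 0] with α hα
    simp only [hw]; field_simp
  have hu2 := Real.tendsto_mul_log_one_add_of_tendsto hu1
  have hw2 := Real.tendsto_mul_log_one_add_of_tendsto hw1
  have hθ2 := lw_theta n hn θ hθ
  have hmain := hθ2.mul ((hu2.add hw2).const_mul (-(1 / 2)))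
  have hval : (2 / (n : ℝ)) * (-(1 / 2) * (-((p i)⁻¹ * lwF A p i j hij ρ)
      + -((p j)⁻¹ * lwF A p j i hij.symm ρ))) = (n : ℝ)⁻¹ *
      ((p i)⁻¹ * lwF A p i j hij ρ + (p j)⁻¹ * lwF A p j i hij.symm ρ) := by
    ring
  rw [hval] at hmain
  refine hmain.congr' ?_
  filter_upwards [eventually_gt_atTop 0, hdets j, hdets i,
    eventually_all.2 hdets,
    hu0.eventually_const_lt (show (-1 : ℝ) < 0 by norm_num),
    hw0.eventually_const_lt (show (-1 : ℝ) < 0 by norm_num)] with α hα hj hi hall huα hwα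
  have hs : 0 < α⁻¹ := inv_pos.2 hα
  set l := ρ + α⁻¹ with hl
  have hlpos : 0 < l := by positivity
  have hB : (1 - l⁻¹ • A).det ≠ 0 := by
    intro h
    obtain ⟨x, hx, hx0⟩ := Matrix.exists_mulVec_eq_zero_iff.2 h
    have h1 : A.mulVec x = l • x := by
      rw [Matrix.sub_mulVec, Matrix.one_mulVec, Matrix.smul_mulVec, sub_eq_zero] at hx0
      nth_rewrite 2 [hx0]
      rw [smul_smul, mul_inv_cancel₀ hlpos.ne', one_smul]
    have := hspec l x hx h1
    rw [abs_of_pos hlpos] at this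
    linarith
  set N := (1 - l⁻¹ • A)⁻¹ with hN
  have hBN : (1 - l⁻¹ • A) * N = 1 := Matrix.mul_nonsing_inv _ (isUnit_iff_ne_zero.2 hB)
  have hNB : N * (1 - l⁻¹ • A) = 1 := Matrix.nonsing_inv_mul _ (isUnit_iff_ne_zero.2 hB)
  have hNsym : ∀ a b, N a b = N b a := by
    have : Nᵀ = N := by
      rw [hN, Matrix.transpose_nonsing_inv, Matrix.transpose_sub, Matrix.transpose_smul,
        Matrix.transpose_one, hsym]
    intro a b
    nth_rewrite 1 [← this]
    rfl
  have hcol : ∀ b k, k ≠ b → l * N k b - (A.mulVec (fun m => N m b)) k = 0 := by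
    intro b k hk
    have h1 : ((1 - l⁻¹ • A) * N) k b = 0 := by rw [hBN, Matrix.one_apply_ne hk]
    rw [Matrix.sub_mul, Matrix.one_mul, Matrix.smul_mul, Matrix.sub_apply, Matrix.smul_apply,
      smul_eq_mul] at h1
    have h2 : (A.mulVec (fun m => N m b)) k = (A * N) k b := rfl
    rw [h2]
    have h3 : l * (N k b - l⁻¹ * (A * N) k b) = 0 := by rw [h1, mul_zero]
    rw [mul_sub, ← mul_assoc, mul_inv_cancel₀ hlpos.ne', one_mul] at h3
    exact h3
  have hdiag : ∀ b, N b b ≠ 0 := by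
    intro b hb
    have hz : ∀ k, N k b = 0 := by
      intro k
      by_cases hk : k = b
      · rw [hk, hb]
      · have := lw_key A p (fun m => N m b) ρ l hAp k b hk (hcol b) (hall b)
        simp only [hb, zero_mul] at this
        exact (mul_eq_zero.1 this).resolve_right (hp b).ne'
    have h1 : ((1 - l⁻¹ • A) * N) b b = 1 := by rw [hBN, Matrix.one_apply_eq]
    rw [Matrix.mul_apply] at h1
    simp [hz] at h1
  have hls : l - ρ = α⁻¹ := by rw [hl]; ring
  have k1 : N i j * p j = N j j * (p i * (1 + u α)) := by
    rw [lw_key A p (fun m => N m j) ρ l hAp i j hij (hcol j) hj, hls]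
    have := (hp i).ne'
    simp only [hu, ← hl, lwF]
    field_simp
    ring
  have k2 : N j i * p i = N i i * (p j * (1 + w α)) := by
    rw [lw_key A p (fun m => N m i) ρ l hAp j i hij.symm (hcol i) hi, hls]
    have := (hp j).ne'
    simp only [hw, ← hl, lwF]
    field_simp
    ring
  have hu' : 0 < 1 + u α := by linarith
  have hw' : 0 < 1 + w α := by linarith
  have hNij : N i j ≠ 0 := by
    intro h
    rw [h, zero_mul] at k1
    exact mul_ne_zero (hdiag j) (mul_pos (hp i) hu').ne' k1.symm
  have hsq : N i j ^ 2 = (N i i * N j j) * ((1 + u α) * (1 + w α)) := by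
    rw [hNsym j i] at k2
    have h1 := (hp i).ne'
    have h2 := (hp j).ne'
    have : N i j ^ 2 * (p i * p j)
        = (N i i * N j j) * ((1 + u α) * (1 + w α)) * (p i * p j) := by
      calc N i j ^ 2 * (p i * p j) = (N i j * p j) * (N i j * p i) := by ring
        _ = _ := by rw [k1, k2]; ring
    exact mul_right_cancel₀ (mul_ne_zero h1 h2) this
  rw [hd, ← hN, lw_logsqrt _ _ _ hsq (mul_pos hu' hw') hNij, Real.log_mul hu'.ne' hw'.ne']
  field_simp
end

section
/- Let A be an n×n real symmetric matrix (n > 1) with nonnegative entries that is irreducible, ρ its Perron root, and p a strictly positive eigenvector with A p = ρ p and ker(ρI − A) = span{p}. Define d^LW(i,j) = n^{-1}( p_i^{-1}((ρI − A_ĵĵ)^{-1} p_ĵ)_i + p_j^{-1}((ρI − A_îî)^{-1} p_î)_j ) for i ≠ j and d^LW(i,i) = 0. Then d^LW is a metric: d^LW(i,j) > 0 for i ≠ j, d^LW(i,j) = d^LW(j,i), and d^LW(i,j) + d^LW(j,k) ≥ d^LW(i,k) for all i, j, k. -/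
open Matrix

/-- The long walk distance. -/
noncomputable def dLW {n : ℕ} (A : Matrix (Fin n) (Fin n) ℝ) (ρ : ℝ) (p : Fin n → ℝ)
    (i j : Fin n) : ℝ :=
  if hij : i = j then 0
  else
    (n : ℝ)⁻¹ *
      ((p i)⁻¹ *
        ((ρ • (1 : Matrix {k : Fin n // k ≠ j} {k : Fin n // k ≠ j} ℝ)
          - delSub A j)⁻¹.mulVec (delVec p j)) ⟨i, hij⟩ +
       (p j)⁻¹ *
        ((ρ • (1 : Matrix {k : Fin n // k ≠ i} {k : Fin n // k ≠ i} ℝ)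
          - delSub A i)⁻¹.mulVec (delVec p i)) ⟨j, Ne.symm hij⟩)

/-- Minimum principle for `ρ I - A`. -/
lemma lw_minPrinciple {n : ℕ} (A : Matrix (Fin n) (Fin n) ℝ)
    (hA : ∀ i j, 0 ≤ A i j)
    (hirr : ∀ i j : Fin n, i ≠ j → ∃ k : ℕ, 1 ≤ k ∧ 0 < (A ^ k) i j)
    (ρ : ℝ) (p : Fin n → ℝ) (hp : ∀ i, 0 < p i)
    (hAp : A.mulVec p = ρ • p) (S : Set (Fin n)) (s : Fin n) (hs : s ∈ S)
    (u : Fin n → ℝ) (huS : ∀ i ∈ S, 0 ≤ u i)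
    (hu : ∀ i, i ∉ S → (A.mulVec u) i ≤ ρ * u i) : ∀ i, 0 ≤ u i := by
  obtain ⟨i0, -, hi0⟩ := Finset.exists_min_image Finset.univ (fun i => u i / p i)
    ⟨s, Finset.mem_univ s⟩
  by_contra hcon
  push Not at hcon
  obtain ⟨t, ht⟩ := hcon
  set m := u i0 / p i0 with hm
  have hmneg : m < 0 := lt_of_le_of_lt (hi0 t (Finset.mem_univ t)) (div_neg_of_neg_of_pos ht (hp t))
  set w : Fin n → ℝ := u - m • p with hw
  have hwi : ∀ i, w i = u i - m * p i := fun i => by simp [hw]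
  have hw0 : ∀ i, 0 ≤ w i := by
    intro i
    have h1 := hi0 i (Finset.mem_univ i)
    rw [le_div_iff₀ (hp i)] at h1
    rw [hwi]; linarith
  have hwS : ∀ i, w i = 0 → i ∉ S := by
    intro i h hiS
    have h1 := huS i hiS
    have h2 := mul_neg_of_neg_of_pos hmneg (hp i)
    rw [hwi] at h
    linarith
  have hstep : ∀ i l, w i = 0 → 0 < A i l → w l = 0 := by
    intro i l h hl
    have h1 := hu i (hwS i h)
    have h2 : (A.mulVec w) i ≤ 0 := by
      have : (A.mulVec w) i = (A.mulVec u) i - m * (ρ * p i) := by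
        rw [hw, Matrix.mulVec_sub, Matrix.mulVec_smul, hAp]; simp
      rw [this]
      rw [hwi] at h
      have : u i = m * p i := by linarith
      rw [this] at h1
      linarith
    have h3 : A i l * w l ≤ (A.mulVec w) i := by
      simp only [Matrix.mulVec, dotProduct]
      exact Finset.single_le_sum (f := fun x => A i x * w x)
        (fun x _ => mul_nonneg (hA i x) (hw0 x)) (Finset.mem_univ l)
    have h4 : A i l * w l = 0 := le_antisymm (h3.trans h2) (mul_nonneg hl.le (hw0 l))
    rcases mul_eq_zero.1 h4 with h5 | h5
    · exact absurd h5 hl.ne'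
    · exact h5
  have hpow : ∀ k i, w i = 0 → 0 < (A ^ k) i s → w s = 0 := by
    intro k
    induction k with
    | zero =>
      intro i h hk
      by_cases his : i = s
      · rwa [← his]
      · simp [his] at hk
    | succ k ih =>
      intro i h hk
      rw [pow_succ', Matrix.mul_apply] at hk
      obtain ⟨l, -, hl⟩ := Finset.exists_lt_of_sum_lt (s := Finset.univ) (f := fun _ => (0:ℝ))
        (by simpa using hk)
      have hl1 : 0 < A i l := by
        rcases (hA i l).eq_or_lt with h0 | h0
        · rw [← h0] at hl; simp at hl
        · exact h0
      exact ih l (hstep i l h hl1) (pos_of_mul_pos_right hl hl1.le)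
  have hi0w : w i0 = 0 := by
    rw [hwi, hm, div_mul_cancel₀ _ (hp i0).ne', sub_self]
  by_cases his : i0 = s
  · exact hwS i0 hi0w (his ▸ hs)
  · obtain ⟨k, -, hk⟩ := hirr i0 s his
    exact hwS s (hpow k i0 hi0w hk) hs

/-- Extension by zero. -/
noncomputable def lwExt {n : ℕ} (j : Fin n) (v : {i : Fin n // i ≠ j} → ℝ) (i : Fin n) : ℝ :=
  if h : i = j then 0 else v ⟨i, h⟩

lemma lwExt_self {n : ℕ} (j : Fin n) (v : {i : Fin n // i ≠ j} → ℝ) : lwExt j v j = 0 := by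
  simp [lwExt]

lemma lwExt_ne {n : ℕ} (j : Fin n) (v : {i : Fin n // i ≠ j} → ℝ) (i : Fin n) (h : i ≠ j) :
    lwExt j v i = v ⟨i, h⟩ := by
  simp [lwExt, h]

lemma lwExt_mulVec {n : ℕ} (A : Matrix (Fin n) (Fin n) ℝ) (ρ : ℝ) (j : Fin n)
    (v : {i : Fin n // i ≠ j} → ℝ) (i : {i : Fin n // i ≠ j}) :
    ((ρ • (1 : Matrix {k : Fin n // k ≠ j} {k : Fin n // k ≠ j} ℝ) - delSub A j).mulVec v) i
      = ρ * lwExt j v i - (A.mulVec (lwExt j v)) i := by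
  rw [Matrix.sub_mulVec, Matrix.smul_mulVec, Matrix.one_mulVec]
  simp only [Pi.sub_apply, Pi.smul_apply, smul_eq_mul]
  rw [lwExt_ne j v i i.2]
  congr 1
  simp only [Matrix.mulVec, dotProduct, delSub, Matrix.submatrix_apply]
  rw [Fintype.sum_eq_add_sum_subtype_ne _ j, lwExt_self, mul_zero, zero_add]
  exact Finset.sum_congr rfl fun x _ => by rw [lwExt_ne j v x x.2]

lemma lw_isUnit {n : ℕ} (A : Matrix (Fin n) (Fin n) ℝ)
    (hA : ∀ i j, 0 ≤ A i j)
    (hirr : ∀ i j : Fin n, i ≠ j → ∃ k : ℕ, 1 ≤ k ∧ 0 < (A ^ k) i j)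
    (ρ : ℝ) (p : Fin n → ℝ) (hp : ∀ i, 0 < p i)
    (hAp : A.mulVec p = ρ • p) (j : Fin n) :
    IsUnit (ρ • (1 : Matrix {k : Fin n // k ≠ j} {k : Fin n // k ≠ j} ℝ) - delSub A j).det := by
  rw [isUnit_iff_ne_zero]
  intro hdet
  obtain ⟨v, hv, hMv⟩ := Matrix.exists_mulVec_eq_zero_iff.2 hdet
  apply hv
  have key : ∀ v : {i : Fin n // i ≠ j} → ℝ,
      (ρ • (1 : Matrix {k : Fin n // k ≠ j} {k : Fin n // k ≠ j} ℝ) - delSub A j).mulVec v = 0 →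
      ∀ i, 0 ≤ lwExt j v i := by
    intro v hv
    apply lw_minPrinciple A hA hirr ρ p hp hAp {j} j rfl
    · rintro i rfl
      rw [lwExt_self]
    · intro i hi
      have h1 := lwExt_mulVec A ρ j v ⟨i, hi⟩
      rw [hv] at h1
      simp only [Pi.zero_apply] at h1
      linarith
  funext i
  have h1 := key v hMv i
  have h2 := key (-v) (by rw [Matrix.mulVec_neg, hMv, neg_zero]) i
  rw [lwExt_ne _ _ _ i.2] at h1 h2
  simp only [Pi.neg_apply] at h2
  simp only [Pi.zero_apply]
  linarith

/-- The extended solution (hitting potential). -/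
noncomputable def lwH {n : ℕ} (A : Matrix (Fin n) (Fin n) ℝ) (ρ : ℝ) (p : Fin n → ℝ)
    (j : Fin n) : Fin n → ℝ :=
  lwExt j ((ρ • (1 : Matrix {k : Fin n // k ≠ j} {k : Fin n // k ≠ j} ℝ)
          - delSub A j)⁻¹.mulVec (delVec p j))

lemma dLW_eq_lwH {n : ℕ} (A : Matrix (Fin n) (Fin n) ℝ) (ρ : ℝ) (p : Fin n → ℝ) (i j : Fin n) :
    dLW A ρ p i j = (n : ℝ)⁻¹ * ((p i)⁻¹ * lwH A ρ p j i + (p j)⁻¹ * lwH A ρ p i j) := by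
  unfold dLW lwH
  split_ifs with h
  · subst h
    simp [lwExt_self]
  · rw [lwExt_ne _ _ _ h, lwExt_ne _ _ _ (Ne.symm h)]

/-- the long walk distance is a metric. -/
theorem long_walk_distance_is_metric
    {n : ℕ} (hn : 1 < n) (A : Matrix (Fin n) (Fin n) ℝ)
    (hsym : A.IsSymm) (hA : ∀ i j, 0 ≤ A i j)
    (hirr : ∀ i j : Fin n, i ≠ j → ∃ k : ℕ, 1 ≤ k ∧ 0 < (A ^ k) i j)
    (ρ : ℝ) (hρ : 0 < ρ) (p : Fin n → ℝ) (hp : ∀ i, 0 < p i)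
    (hAp : A.mulVec p = ρ • p)
    (hspec : ∀ (μ : ℝ) (v : Fin n → ℝ), v ≠ 0 → A.mulVec v = μ • v → |μ| ≤ ρ)
    (hker : ∀ v : Fin n → ℝ, A.mulVec v = ρ • v → ∃ c : ℝ, v = c • p) :
    (∀ i j : Fin n, i ≠ j → 0 < dLW A ρ p i j) ∧
    (∀ i j : Fin n, dLW A ρ p i j = dLW A ρ p j i) ∧
    (∀ i j k : Fin n, dLW A ρ p i k ≤ dLW A ρ p i j + dLW A ρ p j k) := by
  have hself : ∀ j, lwH A ρ p j j = 0 := fun j => lwExt_self _ _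
  have heq : ∀ j i, i ≠ j → (A.mulVec (lwH A ρ p j)) i = ρ * lwH A ρ p j i - p i := by
    intro j i hij
    have h1 := lwExt_mulVec A ρ j ((ρ • (1 : Matrix {k : Fin n // k ≠ j} {k : Fin n // k ≠ j} ℝ)
          - delSub A j)⁻¹.mulVec (delVec p j)) ⟨i, hij⟩
    rw [Matrix.mulVec_mulVec, Matrix.mul_nonsing_inv _ (lw_isUnit A hA hirr ρ p hp hAp j),
      Matrix.one_mulVec] at h1
    simp only [delVec] at h1
    unfold lwH
    linarith
  have hnonneg : ∀ j i, 0 ≤ lwH A ρ p j i := by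
    intro j
    apply lw_minPrinciple A hA hirr ρ p hp hAp {j} j rfl
    · rintro i rfl
      rw [hself]
    · intro i hi
      rw [heq j i hi]
      linarith [hp i]
  have hpos : ∀ j i, i ≠ j → 0 < lwH A ρ p j i := by
    intro j i hij
    have h1 := heq j i hij
    have h2 : 0 ≤ (A.mulVec (lwH A ρ p j)) i := by
      simp only [Matrix.mulVec, dotProduct]
      exact Finset.sum_nonneg fun x _ => mul_nonneg (hA i x) (hnonneg j x)
    have h3 : 0 < ρ * lwH A ρ p j i := by linarith [hp i]
    exact pos_of_mul_pos_right h3 hρ.le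
  have htri : ∀ i j k, (p i)⁻¹ * lwH A ρ p k i ≤
      (p i)⁻¹ * lwH A ρ p j i + (p j)⁻¹ * lwH A ρ p k j := by
    intro i j k
    have h := lw_minPrinciple A hA hirr ρ p hp hAp {j, k} j (by simp)
      (lwH A ρ p j + ((p j)⁻¹ * lwH A ρ p k j) • p - lwH A ρ p k) ?_ ?_ i
    · simp only [Pi.sub_apply, Pi.add_apply, Pi.smul_apply, smul_eq_mul] at h
      have h1 := mul_nonneg (inv_pos.2 (hp i)).le h
      have h2 : (p i)⁻¹ * (lwH A ρ p j i + (p j)⁻¹ * lwH A ρ p k j * p i - lwH A ρ p k i) =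
        (p i)⁻¹ * lwH A ρ p j i + (p j)⁻¹ * lwH A ρ p k j - (p i)⁻¹ * lwH A ρ p k i := by
        have := (hp i).ne'
        field_simp
      rw [h2] at h1
      linarith
    · intro l hl
      simp only [Pi.sub_apply, Pi.add_apply, Pi.smul_apply, smul_eq_mul]
      rcases hl with rfl | hl
      · rw [hself, mul_right_comm, inv_mul_cancel₀ (hp l).ne']
        simp
      · rw [Set.mem_singleton_iff] at hl
        subst hl
        rw [hself]
        have h1 := mul_nonneg (mul_nonneg (inv_pos.2 (hp j)).le (hnonneg l j)) (hp l).le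
        have h2 := hnonneg j l
        linarith
    · intro l hl
      simp only [Set.mem_insert_iff, Set.mem_singleton_iff, not_or] at hl
      rw [Matrix.mulVec_sub, Matrix.mulVec_add, Matrix.mulVec_smul, hAp]
      simp only [Pi.sub_apply, Pi.add_apply, Pi.smul_apply, smul_eq_mul]
      rw [heq j l hl.1, heq k l hl.2]
      apply le_of_eq
      ring
  have hn0 : (0 : ℝ) < (n : ℝ)⁻¹ := inv_pos.2 (by exact_mod_cast (by omega : 0 < n))
  refine ⟨?_, ?_, ?_⟩
  · intro i j hij
    rw [dLW_eq_lwH]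
    exact mul_pos hn0 (add_pos (mul_pos (inv_pos.2 (hp i)) (hpos j i hij))
      (mul_pos (inv_pos.2 (hp j)) (hpos i j hij.symm)))
  · intro i j
    rw [dLW_eq_lwH, dLW_eq_lwH, add_comm]
  · intro i j k
    rw [dLW_eq_lwH, dLW_eq_lwH, dLW_eq_lwH, ← mul_add]
    apply mul_le_mul_of_nonneg_left _ hn0.le
    linarith [htri i j k, htri k j i]
end

section
/- Let A be an n×n real symmetric matrix (n > 1) with nonnegative entries that is irreducible and ρ its Perron root. For α > 0 define the matrix A(α) by A(α)_{kl} = (a_{kl}/ρ) · exp(−1/(α·a_{kl})) if a_{kl} > 0 and A(α)_{kl} = 0 otherwise. Then the series ∑_{m≥0} A(α)^m converges to R̃_α = (I − A(α))^{-1}, whose entries r̃_{kl}(α) are positive; and for all indices i ≠ j, lim_{α → 0+} ( −α · ln( r̃_{ij}(α) / √( r̃_{ii}(α) · r̃_{jj}(α) ) ) ) = d^ws(i,j), where d^ws(i,j) is the weighted shortest path distance: the minimum, over all finite sequences of vertices i = v_0, v_1, …, v_m = j with a_{v_{k-1} v_k} > 0 for all k, of ∑_{k=1}^{m} 1/a_{v_{k-1}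 v_k}. -/
open Matrix Filter Topology

/-- Neumann series of a nonnegative matrix with a strict weighted contraction bound. -/
theorem ews_pow_le {n : ℕ} (B : Matrix (Fin n) (Fin n) ℝ) (hB : ∀ i j, 0 ≤ B i j)
    (c : ℝ) (hc0 : 0 ≤ c) (w : Fin n → ℝ) (hw : ∀ i, 0 < w i)
    (h : ∀ i, ∑ l, B i l * w l ≤ c * w i) (m : ℕ) (i j : Fin n) :
    0 ≤ (B ^ m) i j ∧ (B ^ m) i j ≤ c ^ m * (w i / w j) := by
  induction m generalizing i with
  | zero =>
    by_cases hij : i = j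
    · subst hij
      simp [(hw i).ne']
    · simp only [pow_zero, Matrix.one_apply_ne hij, one_mul]
      exact ⟨le_rfl, (div_pos (hw i) (hw j)).le⟩
  | succ m ih =>
    rw [pow_succ', Matrix.mul_apply]
    refine ⟨Finset.sum_nonneg fun l _ => mul_nonneg (hB i l) (ih l).1, ?_⟩
    calc ∑ l, B i l * (B ^ m) l j ≤ ∑ l, B i l * (c ^ m * (w l / w j)) :=
          Finset.sum_le_sum fun l _ => mul_le_mul_of_nonneg_left (ih l).2 (hB i l)
      _ = c ^ m / w j * ∑ l, B i l * w l := by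
          rw [Finset.mul_sum]
          exact Finset.sum_congr rfl fun l _ => by ring
      _ ≤ c ^ m / w j * (c * w i) :=
          mul_le_mul_of_nonneg_left (h i) (div_nonneg (pow_nonneg hc0 m) (hw j).le)
      _ = c ^ (m + 1) * (w i / w j) := by ring

theorem ews_neumann {n : ℕ} (B : Matrix (Fin n) (Fin n) ℝ) (hB : ∀ i j, 0 ≤ B i j)
    (c : ℝ) (hc0 : 0 ≤ c) (hc1 : c < 1) (w : Fin n → ℝ) (hw : ∀ i, 0 < w i)
    (h : ∀ i, ∑ l, B i l * w l ≤ c * w i) :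
    HasSum (fun m : ℕ => B ^ m) (1 - B)⁻¹ ∧
      (∀ m i j, (B ^ m) i j ≤ (1 - B)⁻¹ i j) ∧
      (∀ i j, (1 - B)⁻¹ i j ≤ (1 - c)⁻¹ * (w i / w j)) := by
  have key := ews_pow_le B hB c hc0 w hw h
  have hs : ∀ i j, Summable (fun m : ℕ => (B ^ m) i j) := fun i j =>
    Summable.of_nonneg_of_le (fun m => (key m i j).1) (fun m => (key m i j).2)
      ((summable_geometric_of_lt_one hc0 hc1).mul_right _)
  have hS : Summable (fun m : ℕ => B ^ m) :=
    Pi.summable.2 fun i => Pi.summable.2 fun j => hs i j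
  have hinv : (1 - B)⁻¹ = ∑' m : ℕ, B ^ m :=
    Matrix.inv_eq_left_inv hS.tsum_pow_mul_one_sub
  have hsum : HasSum (fun m : ℕ => B ^ m) (1 - B)⁻¹ := hinv ▸ hS.hasSum
  have hent : ∀ i j, HasSum (fun m : ℕ => (B ^ m) i j) ((1 - B)⁻¹ i j) := fun i j =>
    Pi.hasSum.1 (Pi.hasSum.1 hsum i) j
  refine ⟨hsum, fun m i j => ?_, fun i j => ?_⟩
  · exact le_hasSum (hent i j) m fun k _ => (key k i j).1
  · exact hasSum_le (fun m => (key m i j).2) (hent i j)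
      ((hasSum_geometric_of_lt_one hc0 hc1).mul_right _)

theorem ews_pow_nonneg {n : ℕ} (B : Matrix (Fin n) (Fin n) ℝ) (hB : ∀ i j, 0 ≤ B i j)
    (m : ℕ) (i j : Fin n) : 0 ≤ (B ^ m) i j := by
  induction m generalizing i with
  | zero =>
    rw [pow_zero, Matrix.one_apply]
    split_ifs <;> norm_num
  | succ m ih =>
    rw [pow_succ', Matrix.mul_apply]
    exact Finset.sum_nonneg fun l _ => mul_nonneg (hB i l) (ih l)

theorem ews_walk_le {n : ℕ} (B : Matrix (Fin n) (Fin n) ℝ) (hB : ∀ i j, 0 ≤ B i j)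
    (v : ℕ → Fin n) (m : ℕ) :
    ∏ k ∈ Finset.range m, B (v k) (v (k + 1)) ≤ (B ^ m) (v 0) (v m) := by
  induction m with
  | zero => simp
  | succ m ih =>
    rw [Finset.prod_range_succ, pow_succ, Matrix.mul_apply]
    refine (mul_le_mul_of_nonneg_right ih (hB _ _)).trans ?_
    exact Finset.single_le_sum (f := fun l => (B ^ m) (v 0) l * B l (v (m + 1)))
      (fun l _ => mul_nonneg (ews_pow_nonneg B hB m _ _) (hB _ _)) (Finset.mem_univ (v m))

/-- The set of weighted lengths of walks from `i` to `j`. -/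
def ewsSet {n : ℕ} (A : Matrix (Fin n) (Fin n) ℝ) (i j : Fin n) : Set ℝ :=
  {d : ℝ | ∃ (m : ℕ) (v : ℕ → Fin n), v 0 = i ∧ v m = j ∧
        (∀ k < m, 0 < A (v k) (v (k + 1))) ∧
        d = ∑ k ∈ Finset.range m, (A (v k) (v (k + 1)))⁻¹}

theorem ewsSet_nonneg {n : ℕ} (A : Matrix (Fin n) (Fin n) ℝ) (i j : Fin n)
    (d : ℝ) (hd : d ∈ ewsSet A i j) : 0 ≤ d := by
  obtain ⟨m, v, -, -, h, rfl⟩ := hd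
  exact Finset.sum_nonneg fun k hk => (inv_pos.2 (h k (Finset.mem_range.1 hk))).le

theorem ewsSet_zero {n : ℕ} (A : Matrix (Fin n) (Fin n) ℝ) (i : Fin n) :
    (0 : ℝ) ∈ ewsSet A i i :=
  ⟨0, fun _ => i, rfl, rfl, by simp, by simp⟩

theorem ewsSet_cons {n : ℕ} (A : Matrix (Fin n) (Fin n) ℝ) (i l j : Fin n) (h : 0 < A i l)
    (d : ℝ) (hd : d ∈ ewsSet A l j) : (A i l)⁻¹ + d ∈ ewsSet A i j := by
  obtain ⟨m, v, h0, hm, hv, rfl⟩ := hd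
  refine ⟨m + 1, fun k => Nat.casesOn k i v, rfl, hm, ?_, ?_⟩
  · intro k hk
    cases k with
    | zero => simpa [h0] using h
    | succ k => exact hv k (by omega)
  · rw [Finset.sum_range_succ', add_comm]
    simp [h0]

theorem ewsSet_nonempty_of_pow {n : ℕ} (A : Matrix (Fin n) (Fin n) ℝ) (hA : ∀ i j, 0 ≤ A i j)
    (m : ℕ) (i j : Fin n) (h : 0 < (A ^ m) i j) : (ewsSet A i j).Nonempty := by
  induction m generalizing i with
  | zero =>
    by_cases hij : i = j
    · subst hij
      exact ⟨0, ewsSet_zero A i⟩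
    · simp [Matrix.one_apply_ne hij] at h
  | succ m ih =>
    rw [pow_succ', Matrix.mul_apply] at h
    obtain ⟨l, -, hl⟩ := Finset.exists_lt_of_sum_lt (s := Finset.univ) (f := fun _ : Fin n => (0 : ℝ))
      (by simpa using h)
    have h1 := hA i l
    have h2 := ews_pow_nonneg A hA m l j
    have h3 : 0 < A i l := lt_of_le_of_ne h1 fun e => by simp [← e] at hl
    have h4 : 0 < (A ^ m) l j := lt_of_le_of_ne h2 fun e => by simp [← e] at hl
    obtain ⟨d, hd⟩ := ih l h4
    exact ⟨_, ewsSet_cons A i l j h3 d hd⟩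

/-- the ε-walk distances converge, as `α → 0⁺`, to the weighted shortest
path distance. -/
theorem eps_walk_distance_to_weighted_shortest_path
    {n : ℕ} (hn : 1 < n) (A : Matrix (Fin n) (Fin n) ℝ)
    (hsym : A.IsSymm) (hA : ∀ i j, 0 ≤ A i j)
    (hirr : ∀ i j : Fin n, i ≠ j → ∃ k : ℕ, 1 ≤ k ∧ 0 < (A ^ k) i j)
    (ρ : ℝ) (hρ : 0 < ρ) (p : Fin n → ℝ) (hp : ∀ i, 0 < p i)
    (hAp : A.mulVec p = ρ • p)
    (hspec : ∀ (μ : ℝ) (v : Fin n → ℝ), v ≠ 0 → A.mulVec v = μ • v → |μ| ≤ ρ)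
    (Aα : ℝ → Matrix (Fin n) (Fin n) ℝ)
    (hAα : ∀ (α : ℝ) (k l : Fin n),
      Aα α k l = if A k l = 0 then 0 else A k l / ρ * Real.exp (-(1 / (α * A k l))))
    (dws : Fin n → Fin n → ℝ)
    (hdws : ∀ i j : Fin n, dws i j =
      sInf {d : ℝ | ∃ (m : ℕ) (v : ℕ → Fin n), v 0 = i ∧ v m = j ∧
        (∀ k < m, 0 < A (v k) (v (k + 1))) ∧
        d = ∑ k ∈ Finset.range m, (A (v k) (v (k + 1)))⁻¹}) :
    (∀ α : ℝ, 0 < α →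
      Summable (fun m : ℕ => (Aα α) ^ m) ∧
      (∑' m : ℕ, (Aα α) ^ m) = (1 - Aα α)⁻¹ ∧
      (∀ k l : Fin n, 0 < (1 - Aα α)⁻¹ k l)) ∧
    (∀ i j : Fin n, i ≠ j →
      Tendsto (fun α : ℝ =>
          -α * Real.log ((1 - Aα α)⁻¹ i j /
            Real.sqrt ((1 - Aα α)⁻¹ i i * (1 - Aα α)⁻¹ j j)))
        (𝓝[>] (0 : ℝ)) (𝓝 (dws i j))) := by
  classical
  have hne : ∀ i j, (ewsSet A i j).Nonempty := by
    intro i j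
    by_cases hij : i = j
    · subst hij
      exact ⟨0, ewsSet_zero A i⟩
    · obtain ⟨k, -, hk⟩ := hirr i j hij
      exact ewsSet_nonempty_of_pow A hA k i j hk
  have hbdd : ∀ i j, BddBelow (ewsSet A i j) := fun i j => ⟨0, fun d hd => ewsSet_nonneg A i j d hd⟩
  have hd' : ∀ i j, dws i j = sInf (ewsSet A i j) := hdws
  have hd0 : ∀ i, dws i i = 0 := by
    intro i
    rw [hd']
    exact le_antisymm (csInf_le (hbdd i i) (ewsSet_zero A i))
      (le_csInf (hne i i) fun d hd => ewsSet_nonneg A i i d hd)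
  have htri : ∀ i l j, 0 < A i l → dws i j ≤ (A i l)⁻¹ + dws l j := by
    intro i l j h
    have : dws i j - (A i l)⁻¹ ≤ dws l j := by
      rw [hd' l j]
      refine le_csInf (hne l j) fun d hd => ?_
      have := csInf_le (hbdd i j) (ewsSet_cons A i l j h d hd)
      rw [← hd' i j] at this
      linarith
    linarith
  obtain ⟨M, hM0, hM⟩ : ∃ M : ℝ, 0 < M ∧ ∀ i j, A i j ≤ M := by
    refine ⟨1 + ∑ i, ∑ j, A i j, ?_, fun i j => ?_⟩
    · have : 0 ≤ ∑ i, ∑ j, A i j := Finset.sum_nonneg fun i _ => Finset.sum_nonneg fun j _ => hA i j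
      linarith
    · have h1 : A i j ≤ ∑ j, A i j :=
        Finset.single_le_sum (f := fun j => A i j) (fun j _ => hA i j) (Finset.mem_univ j)
      have h2 : ∑ j, A i j ≤ ∑ i, ∑ j, A i j :=
        Finset.single_le_sum (f := fun i => ∑ j, A i j)
          (fun i _ => Finset.sum_nonneg fun j _ => hA i j) (Finset.mem_univ i)
      linarith
  have hB0 : ∀ α i j, 0 ≤ Aα α i j := by
    intro α i j
    rw [hAα]
    split_ifs
    · exact le_rfl
    · exact mul_nonneg (div_nonneg (hA i j) hρ.le) (Real.exp_pos _).le
  have hAp' : ∀ i, ∑ l, A i l * p l = ρ * p i := by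
    intro i
    have := congrFun hAp i
    simpa [Matrix.mulVec, dotProduct] using this
  -- weighted contraction
  have hcontr : ∀ (α c : ℝ) (u : Fin n → ℝ),
      (∀ i l, 0 < A i l → Real.exp (-(1 / (α * A i l))) * u l ≤ c * u i) →
      ∀ i, ∑ l, Aα α i l * (u l * p l) ≤ c * (u i * p i) := by
    intro α c u h i
    calc ∑ l, Aα α i l * (u l * p l) ≤ ∑ l, c * u i / ρ * (A i l * p l) := by
          refine Finset.sum_le_sum fun l _ => ?_
          rw [hAα]
          split_ifs with h0
          · simp [h0]
          · have hpos : 0 < A i l := lt_of_le_of_ne (hA i l) (Ne.symm h0)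
            have := mul_le_mul_of_nonneg_left (h i l hpos)
              (mul_nonneg (div_nonneg (hA i l) hρ.le) (hp l).le)
            calc _ = A i l / ρ * p l * (Real.exp (-(1 / (α * A i l))) * u l) := by ring
              _ ≤ _ := this
              _ = _ := by ring
      _ = c * (u i * p i) := by
          rw [← Finset.mul_sum, hAp']
          field_simp
  have hN1 : ∀ α, 0 < α → HasSum (fun m : ℕ => (Aα α) ^ m) (1 - Aα α)⁻¹ ∧
      (∀ m i j, ((Aα α) ^ m) i j ≤ (1 - Aα α)⁻¹ i j) := by
    intro α hα
    have := ews_neumann (Aα α) (hB0 α) (Real.exp (-(1 / (α * M)))) (Real.exp_pos _).le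
      (by rw [Real.exp_lt_one_iff]; exact neg_neg_of_pos (by positivity))
      (fun i => 1 * p i) (fun i => by simpa using hp i)
      (hcontr α _ (fun _ => 1) (by
        intro i l hil
        rw [mul_one, mul_one]
        apply Real.exp_le_exp.2
        apply neg_le_neg
        apply one_div_le_one_div_of_le (by positivity)
        exact mul_le_mul_of_nonneg_left (hM i l) hα.le))
    exact ⟨this.1, this.2.1⟩
  -- lower bound by walks
  have hlow : ∀ i j, ∀ d ∈ ewsSet A i j, ∃ C : ℝ, 0 < C ∧ ∀ α, 0 < α →
      C * Real.exp (-(d / α)) ≤ (1 - Aα α)⁻¹ i j := by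
    rintro i j d ⟨m, v, h0, hm, hv, rfl⟩
    refine ⟨∏ k ∈ Finset.range m, A (v k) (v (k + 1)) / ρ,
      Finset.prod_pos fun k hk => div_pos (hv k (Finset.mem_range.1 hk)) hρ, fun α hα => ?_⟩
    have h1 := ews_walk_le (Aα α) (hB0 α) v m
    rw [h0, hm] at h1
    refine le_trans (le_of_eq ?_) (h1.trans ((hN1 α hα).2 m i j))
    rw [Finset.sum_div, ← Finset.sum_neg_distrib, Real.exp_sum, ← Finset.prod_mul_distrib]
    refine Finset.prod_congr rfl fun k hk => ?_
    have := hv k (Finset.mem_range.1 hk)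
    rw [hAα, if_neg this.ne']
    congr 2
    field_simp
  have hpos : ∀ α, 0 < α → ∀ k l, 0 < (1 - Aα α)⁻¹ k l := by
    intro α hα k l
    obtain ⟨d, hd⟩ := hne k l
    obtain ⟨C, hC, h⟩ := hlow k l d hd
    exact lt_of_lt_of_le (mul_pos hC (Real.exp_pos _)) (h α hα)
  -- upper bound
  have hup : ∀ i j, ∃ K : ℝ, 0 < K ∧ ∀ α, 0 < α → α ≤ 1 →
      (1 - Aα α)⁻¹ i j ≤ K * Real.exp (-(dws i j / α)) := by
    intro i j
    have hc1 : Real.exp (-(1 / M)) < 1 := by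
      rw [Real.exp_lt_one_iff]; exact neg_neg_of_pos (by positivity)
    refine ⟨(1 - Real.exp (-(1 / M)))⁻¹ * (p i / p j) * Real.exp (dws i j),
      mul_pos (mul_pos (inv_pos.2 (by linarith)) (div_pos (hp i) (hp j))) (Real.exp_pos _),
      fun α hα hα1 => ?_⟩
    have := (ews_neumann (Aα α) (hB0 α) (Real.exp (-(1 / M))) (Real.exp_pos _).le hc1
      (fun i => Real.exp (dws i j - dws i j / α) * p i)
      (fun i => mul_pos (Real.exp_pos _) (hp i))
      (hcontr α _ (fun i => Real.exp (dws i j - dws i j / α)) (by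
        intro i l hil
        rw [← Real.exp_add, ← Real.exp_add]
        apply Real.exp_le_exp.2
        have h1 := htri i l j hil
        have h2 : 1 / M ≤ (A i l)⁻¹ := by
          rw [← one_div]
          exact one_div_le_one_div_of_le hil (hM i l)
        have h3 : 0 ≤ 1 / α - 1 := by
          rw [sub_nonneg, le_div_iff₀ hα]; linarith
        have h4 := mul_le_mul_of_nonneg_left h1 h3
        have h5 : 1 / (α * A i l) = (1 / α) * (A i l)⁻¹ := by
          field_simp
        have h6 : ∀ x : ℝ, x / α = (1 / α) * x := fun x => by ring
        rw [h5, h6 (dws l j), h6 (dws i j)]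
        nlinarith))).2.2 i j
    refine this.trans (le_of_eq ?_)
    simp only [hd0, zero_div, sub_zero, Real.exp_zero, one_mul]
    rw [sub_eq_add_neg (dws i j), Real.exp_add]
    ring
  refine ⟨fun α hα => ⟨(hN1 α hα).1.summable, (hN1 α hα).1.tsum_eq, hpos α hα⟩, ?_⟩
  intro i j hij
  -- diagonal bounds
  have hdiag : ∀ i, ∃ L : ℝ, ∀ α, 0 < α → α ≤ 1 →
      0 ≤ Real.log ((1 - Aα α)⁻¹ i i) ∧ Real.log ((1 - Aα α)⁻¹ i i) ≤ L := by
    intro i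
    obtain ⟨K, hK, h⟩ := hup i i
    refine ⟨Real.log K, fun α hα hα1 => ⟨Real.log_nonneg ?_, Real.log_le_log (hpos α hα i i) ?_⟩⟩
    · simpa using (hN1 α hα).2 0 i i
    · simpa [hd0] using h α hα hα1
  obtain ⟨L1, hL1⟩ := hdiag i
  obtain ⟨L2, hL2⟩ := hdiag j
  have hf : ∀ α, 0 < α → -α * Real.log ((1 - Aα α)⁻¹ i j /
      Real.sqrt ((1 - Aα α)⁻¹ i i * (1 - Aα α)⁻¹ j j)) =
      -α * Real.log ((1 - Aα α)⁻¹ i j) +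
      α * ((Real.log ((1 - Aα α)⁻¹ i i) + Real.log ((1 - Aα α)⁻¹ j j)) / 2) := by
    intro α hα
    have h1 := hpos α hα i i
    have h2 := hpos α hα j j
    rw [Real.log_div (hpos α hα i j).ne' (Real.sqrt_pos.2 (mul_pos h1 h2)).ne',
      Real.log_sqrt (mul_pos h1 h2).le, Real.log_mul h1.ne' h2.ne']
    ring
  have hev : ∀ᶠ α : ℝ in 𝓝[>] (0 : ℝ), 0 < α ∧ α ≤ 1 := by
    filter_upwards [Ioc_mem_nhdsGT (zero_lt_one' ℝ)] with α hα using hα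
  have hlin : ∀ a b : ℝ, Tendsto (fun α : ℝ => a + α * b) (𝓝[>] (0 : ℝ)) (𝓝 a) := by
    intro a b
    have : Continuous (fun α : ℝ => a + α * b) := by fun_prop
    have h := this.tendsto 0
    simp only [zero_mul, add_zero] at h
    exact h.mono_left nhdsWithin_le_nhds
  rw [tendsto_order]
  constructor
  · intro a ha
    obtain ⟨K, hK, h⟩ := hup i j
    filter_upwards [hev, (hlin (dws i j) (-Real.log K)).eventually (lt_mem_nhds ha)] with α hα hlt
    obtain ⟨hα, hα1⟩ := hα
    rw [hf α hα]
    have h1 := Real.log_le_log (hpos α hα i j) (h α hα hα1)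
    rw [Real.log_mul hK.ne' (Real.exp_pos _).ne', Real.log_exp] at h1
    have h2 := mul_le_mul_of_nonneg_left h1 hα.le
    have h3 : α * (Real.log K + -(dws i j / α)) = α * Real.log K - dws i j := by
      field_simp
      ring
    have h4 := mul_nonneg hα.le
      (div_nonneg (add_nonneg (hL1 α hα hα1).1 (hL2 α hα hα1).1) (zero_le_two (α := ℝ)))
    linarith
  · intro a ha
    rw [hd'] at ha
    obtain ⟨d, hd, hda⟩ := exists_lt_of_csInf_lt (hne i j) ha
    obtain ⟨C, hC, h⟩ := hlow i j d hd
    filter_upwards [hev, (hlin d (-Real.log C + (L1 + L2) / 2)).eventually (gt_mem_nhds hda)]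
      with α hα hlt
    obtain ⟨hα, hα1⟩ := hα
    rw [hf α hα]
    have h1 := Real.log_le_log (mul_pos hC (Real.exp_pos _)) (h α hα)
    rw [Real.log_mul hC.ne' (Real.exp_pos _).ne', Real.log_exp] at h1
    have h2 := mul_le_mul_of_nonneg_left h1 hα.le
    have h3 : α * (Real.log C + -(d / α)) = α * Real.log C - d := by
      field_simp
      ring
    have h4 : α * ((Real.log ((1 - Aα α)⁻¹ i i) + Real.log ((1 - Aα α)⁻¹ j j)) / 2) ≤
        α * ((L1 + L2) / 2) := by
      apply mul_le_mul_of_nonneg_left _ hα.le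
      linarith [(hL1 α hα hα1).2, (hL2 α hα hα1).2]
    linarith
end

section
/- Let A be an n×n real symmetric matrix (n > 1) with nonnegative entries that is irreducible, ρ its Perron root, and p a strictly positive eigenvector with A p = ρ p and ker(ρI − A) = span{p}. Let Ǎ be the 0–1 matrix with Ǎ_{kl} = 1 if a_{kl} ≠ 0 and Ǎ_{kl} = 0 otherwise, and set θ_∞ = (2/n) · ( p^T (A/ρ) p ) / ( p^T Ǎ p ). Then for all indices i ≠ j, (θ_∞/2) · ( p_i^{-1} · ∑_{k ≠ j} ∑_{q} ((ρI − A_ĵĵ)^{-1})_{ik} · Ǎ_{kq} · p_q + p_j^{-1} · ∑_{k ≠ i} ∑_{q} ((ρI − A_îî)^{-1})_{jk} · Ǎ_{kq} · p_q ) = n^{-1} · ( p_i^{-1} ((ρI − A_ĵĵ)^{-1} p_ĵ)_i + p_j^{-1} ((ρI − A_îî)^{-1} p_î)_j ); that is, the long ε-walk distance with scaling θ_∞ coincides with the long walk distance. -/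
open Matrix

noncomputable def extZ {n : ℕ} (j : Fin n) (v : {k : Fin n // k ≠ j} → ℝ) : Fin n → ℝ :=
  fun k => if h : k ≠ j then v ⟨k, h⟩ else 0

lemma extZ_self {n : ℕ} (j : Fin n) (v : {k : Fin n // k ≠ j} → ℝ) : extZ j v j = 0 := by
  simp [extZ]

lemma extZ_ne {n : ℕ} (j : Fin n) (v : {k : Fin n // k ≠ j} → ℝ) (k : Fin n) (h : k ≠ j) :
    extZ j v k = v ⟨k, h⟩ := by
  simp [extZ, h]

lemma sum_split {n : ℕ} (j : Fin n) (f : Fin n → ℝ) :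
    ∑ k, f k = (∑ k : {k : Fin n // k ≠ j}, f k) + f j := by
  rw [← Finset.sum_erase_add _ _ (Finset.mem_univ j)]
  congr 1
  apply Finset.sum_subtype
  intro x
  simp

lemma sub_mulVec_ext {n : ℕ} (A : Matrix (Fin n) (Fin n) ℝ) (ρ : ℝ) (j : Fin n)
    (v : {k : Fin n // k ≠ j} → ℝ) (k : {k : Fin n // k ≠ j}) :
    ((ρ • (1 : Matrix {k : Fin n // k ≠ j} {k : Fin n // k ≠ j} ℝ) - delSub A j).mulVec v) k
      = (ρ • extZ j v - A.mulVec (extZ j v)) k := by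
  have h1 : (A.mulVec (extZ j v)) k = ((delSub A j).mulVec v) k := by
    simp only [Matrix.mulVec, dotProduct]
    rw [sum_split j, extZ_self, mul_zero, add_zero]
    refine Finset.sum_congr rfl fun l _ => ?_
    rw [extZ_ne j v l l.2]
    rfl
  rw [Matrix.sub_mulVec, Matrix.smul_mulVec, Matrix.one_mulVec]
  simp only [Pi.sub_apply, Pi.smul_apply, h1, extZ_ne j v k k.2]

lemma dot_zero {n : ℕ} (A : Matrix (Fin n) (Fin n) ℝ) (hsym : A.IsSymm) (ρ : ℝ)
    (p : Fin n → ℝ) (hAp : A.mulVec p = ρ • p) (x : Fin n → ℝ) :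
    p ⬝ᵥ (ρ • x - A.mulVec x) = 0 := by
  rw [dotProduct_sub, Matrix.dotProduct_mulVec, ← Matrix.mulVec_transpose, hsym.eq, hAp,
    dotProduct_smul, smul_dotProduct, sub_self]

lemma ext_eq {n : ℕ} (A : Matrix (Fin n) (Fin n) ℝ) (hsym : A.IsSymm) (ρ : ℝ)
    (p : Fin n → ℝ) (hp : ∀ i, 0 < p i) (hAp : A.mulVec p = ρ • p) (j : Fin n)
    (w : Fin n → ℝ) (x : Fin n → ℝ)
    (hx : ∀ k, k ≠ j → (ρ • x - A.mulVec x) k = w k) :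
    ρ • x - A.mulVec x = w - ((p ⬝ᵥ w) / p j) • (Pi.single j 1 : Fin n → ℝ) := by
  have h := dot_zero A hsym ρ p hAp x
  have hpj := (hp j).ne'
  simp only [dotProduct] at h ⊢
  rw [sum_split j] at h ⊢
  have h2 : ∑ k : {k : Fin n // k ≠ j}, p k * (ρ • x - A.mulVec x) k
      = ∑ k : {k : Fin n // k ≠ j}, p k * w k :=
    Finset.sum_congr rfl fun k _ => by rw [hx k k.2]
  rw [h2] at h
  funext k
  by_cases hk : k = j
  · subst hk
    rw [Pi.sub_apply w, Pi.smul_apply, Pi.single_eq_same, smul_eq_mul, mul_one]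
    field_simp
    linarith
  · rw [hx k hk, Pi.sub_apply, Pi.smul_apply, Pi.single_eq_of_ne hk]
    simp

lemma sub_det {n : ℕ} (A : Matrix (Fin n) (Fin n) ℝ) (hsym : A.IsSymm) (ρ : ℝ)
    (p : Fin n → ℝ) (hp : ∀ i, 0 < p i) (hAp : A.mulVec p = ρ • p)
    (hker : ∀ v : Fin n → ℝ, A.mulVec v = ρ • v → ∃ c : ℝ, v = c • p) (j : Fin n) :
    IsUnit (ρ • (1 : Matrix {k : Fin n // k ≠ j} {k : Fin n // k ≠ j} ℝ) - delSub A j).det := by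
  rw [isUnit_iff_ne_zero]
  intro hd
  obtain ⟨v, hv, hv0⟩ := Matrix.exists_mulVec_eq_zero_iff.2 hd
  have h := ext_eq A hsym ρ p hp hAp j 0 (extZ j v) (fun k hk => by
    have := sub_mulVec_ext A ρ j v ⟨k, hk⟩
    rw [hv0] at this
    exact this.symm)
  simp only [dotProduct_zero, zero_div, zero_smul, sub_zero] at h
  obtain ⟨c, hc⟩ := hker _ (sub_eq_zero.1 h).symm
  have hcj := congrFun hc j
  rw [extZ_self, Pi.smul_apply, smul_eq_mul, eq_comm, mul_eq_zero] at hcj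
  have hc0 : c = 0 := hcj.resolve_right (hp j).ne'
  apply hv
  funext k
  rw [← Subtype.coe_eta k k.2, ← extZ_ne j v k k.2, hc, hc0]
  simp

lemma inv_ext {n : ℕ} (A : Matrix (Fin n) (Fin n) ℝ) (hsym : A.IsSymm) (ρ : ℝ)
    (p : Fin n → ℝ) (hp : ∀ i, 0 < p i) (hAp : A.mulVec p = ρ • p)
    (hker : ∀ v : Fin n → ℝ, A.mulVec v = ρ • v → ∃ c : ℝ, v = c • p) (j : Fin n)
    (w : Fin n → ℝ) :
    ∃ x : Fin n → ℝ, x j = 0 ∧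
      ρ • x - A.mulVec x = w - ((p ⬝ᵥ w) / p j) • (Pi.single j 1 : Fin n → ℝ) ∧
      ∀ k (hk : k ≠ j), ((ρ • (1 : Matrix {k : Fin n // k ≠ j} {k : Fin n // k ≠ j} ℝ)
            - delSub A j)⁻¹.mulVec (delVec w j)) ⟨k, hk⟩ = x k := by
  refine ⟨extZ j ((ρ • (1 : Matrix {k : Fin n // k ≠ j} {k : Fin n // k ≠ j} ℝ)
            - delSub A j)⁻¹.mulVec (delVec w j)), extZ_self _ _, ?_, fun k hk => (extZ_ne _ _ k hk).symm⟩
  apply ext_eq A hsym ρ p hp hAp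
  intro k hk
  rw [← sub_mulVec_ext A ρ j _ ⟨k, hk⟩, Matrix.mulVec_mulVec,
    Matrix.mul_nonsing_inv _ (sub_det A hsym ρ p hp hAp hker j), Matrix.one_mulVec]
  rfl

lemma key {n : ℕ} (A : Matrix (Fin n) (Fin n) ℝ) (hsym : A.IsSymm) (ρ : ℝ)
    (p : Fin n → ℝ) (hp : ∀ i, 0 < p i) (hAp : A.mulVec p = ρ • p)
    (hker : ∀ v : Fin n → ℝ, A.mulVec v = ρ • v → ∃ c : ℝ, v = c • p) (i j : Fin n)
    (hij : i ≠ j) (w u : Fin n → ℝ) :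
    (p ⬝ᵥ u) * ((p i)⁻¹ *
          ((ρ • (1 : Matrix {k : Fin n // k ≠ j} {k : Fin n // k ≠ j} ℝ)
            - delSub A j)⁻¹.mulVec (delVec w j)) ⟨i, hij⟩ +
         (p j)⁻¹ *
          ((ρ • (1 : Matrix {k : Fin n // k ≠ i} {k : Fin n // k ≠ i} ℝ)
            - delSub A i)⁻¹.mulVec (delVec w i)) ⟨j, hij.symm⟩) =
    (p ⬝ᵥ w) * ((p i)⁻¹ *
          ((ρ • (1 : Matrix {k : Fin n // k ≠ j} {k : Fin n // k ≠ j} ℝ)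
            - delSub A j)⁻¹.mulVec (delVec u j)) ⟨i, hij⟩ +
         (p j)⁻¹ *
          ((ρ • (1 : Matrix {k : Fin n // k ≠ i} {k : Fin n // k ≠ i} ℝ)
            - delSub A i)⁻¹.mulVec (delVec u i)) ⟨j, hij.symm⟩) := by
  obtain ⟨x, hx0, hx, hxe⟩ := inv_ext A hsym ρ p hp hAp hker j w
  obtain ⟨y, hy0, hy, hye⟩ := inv_ext A hsym ρ p hp hAp hker i w
  obtain ⟨x', hx0', hx', hxe'⟩ := inv_ext A hsym ρ p hp hAp hker j u
  obtain ⟨y', hy0', hy', hye'⟩ := inv_ext A hsym ρ p hp hAp hker i u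
  rw [hxe, hye, hxe', hye']
  obtain ⟨c, hc⟩ := hker ((p ⬝ᵥ u) • (x - y) - (p ⬝ᵥ w) • (x' - y')) (by
    rw [Matrix.mulVec_sub, Matrix.mulVec_smul, Matrix.mulVec_smul, Matrix.mulVec_sub,
      Matrix.mulVec_sub]
    funext k
    have h1 := congrFun hx k
    have h2 := congrFun hy k
    have h3 := congrFun hx' k
    have h4 := congrFun hy' k
    simp only [Pi.sub_apply, Pi.smul_apply, smul_eq_mul] at h1 h2 h3 h4 ⊢
    linear_combination (-(p ⬝ᵥ u)) * (h1 - h2) + (p ⬝ᵥ w) * (h3 - h4))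
  have hi := congrFun hc i
  have hj := congrFun hc j
  simp only [Pi.sub_apply, Pi.smul_apply, smul_eq_mul, hx0, hy0, hx0', hy0'] at hi hj
  have hpi := (hp i).ne'
  have hpj := (hp j).ne'
  field_simp
  linear_combination (p j) * hi - (p i) * hj

/-- with the scaling factor `θ∞ = (2/n)·(pᵀ(A/ρ)p)/(pᵀ Ǎ p)`, the long
ε-walk distance coincides with the long walk distance. -/
theorem long_eps_walk_eq_long_walk
    {n : ℕ} (hn : 1 < n) (A : Matrix (Fin n) (Fin n) ℝ)
    (hsym : A.IsSymm) (hA : ∀ i j, 0 ≤ A i j)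
    (hirr : ∀ i j : Fin n, i ≠ j → ∃ k : ℕ, 1 ≤ k ∧ 0 < (A ^ k) i j)
    (ρ : ℝ) (hρ : 0 < ρ) (p : Fin n → ℝ) (hp : ∀ i, 0 < p i)
    (hAp : A.mulVec p = ρ • p)
    (hker : ∀ v : Fin n → ℝ, A.mulVec v = ρ • v → ∃ c : ℝ, v = c • p)
    (Ach : Matrix (Fin n) (Fin n) ℝ)
    (hAch : ∀ k l : Fin n, Ach k l = if A k l ≠ 0 then 1 else 0)
    (θinf : ℝ)
    (hθinf : θinf = 2 / (n : ℝ) * (p ⬝ᵥ (ρ⁻¹ • A).mulVec p) / (p ⬝ᵥ Ach.mulVec p)) :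
    ∀ i j : Fin n, ∀ hij : i ≠ j,
      θinf / 2 *
        ((p i)⁻¹ *
          (∑ k : {k : Fin n // k ≠ j}, ∑ q : Fin n,
            ((ρ • (1 : Matrix {k : Fin n // k ≠ j} {k : Fin n // k ≠ j} ℝ)
              - delSub A j)⁻¹) ⟨i, hij⟩ k * Ach k q * p q) +
         (p j)⁻¹ *
          (∑ k : {k : Fin n // k ≠ i}, ∑ q : Fin n,
            ((ρ • (1 : Matrix {k : Fin n // k ≠ i} {k : Fin n // k ≠ i} ℝ)
              - delSub A i)⁻¹) ⟨j, hij.symm⟩ k * Ach k q * p q)) =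
      (n : ℝ)⁻¹ *
        ((p i)⁻¹ *
          ((ρ • (1 : Matrix {k : Fin n // k ≠ j} {k : Fin n // k ≠ j} ℝ)
            - delSub A j)⁻¹.mulVec (delVec p j)) ⟨i, hij⟩ +
         (p j)⁻¹ *
          ((ρ • (1 : Matrix {k : Fin n // k ≠ i} {k : Fin n // k ≠ i} ℝ)
            - delSub A i)⁻¹.mulVec (delVec p i)) ⟨j, hij.symm⟩) := by
  intro i j hij
  have hconv : ∀ (a b : Fin n) (hab : a ≠ b), (∑ k : {k : Fin n // k ≠ b}, ∑ q : Fin n,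
            ((ρ • (1 : Matrix {k : Fin n // k ≠ b} {k : Fin n // k ≠ b} ℝ)
              - delSub A b)⁻¹) ⟨a, hab⟩ k * Ach k q * p q) =
      ((ρ • (1 : Matrix {k : Fin n // k ≠ b} {k : Fin n // k ≠ b} ℝ)
            - delSub A b)⁻¹.mulVec (delVec (Ach.mulVec p) b)) ⟨a, hab⟩ := by
    intro a b hab
    simp only [Matrix.mulVec, dotProduct, delVec, Finset.mul_sum, mul_assoc]
  rw [hconv, hconv]
  have hk := key A hsym ρ p hp hAp hker i j hij (Ach.mulVec p) p
  have hnn : ∀ k l, 0 ≤ p k * (Ach k l * p l) := by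
    intro k l
    rw [hAch]
    have := hp k
    have := hp l
    split_ifs <;> positivity
  have hne : p ⬝ᵥ Ach.mulVec p ≠ 0 := by
    intro h0
    simp only [Matrix.mulVec, dotProduct, Finset.mul_sum] at h0
    rw [Finset.sum_eq_zero_iff_of_nonneg
      (fun k _ => Finset.sum_nonneg fun l _ => hnn k l)] at h0
    have hi := h0 i (Finset.mem_univ _)
    rw [Finset.sum_eq_zero_iff_of_nonneg (fun l _ => hnn i l)] at hi
    have hA0 : ∀ l, A i l = 0 := by
      intro l
      by_contra hl
      have := hi l (Finset.mem_univ _)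
      rw [hAch, if_pos hl] at this
      have h1 := hp i
      have h2 := hp l
      have : 0 < p i * (1 * p l) := by positivity
      linarith
    have := congrFun hAp i
    simp only [Matrix.mulVec, dotProduct, hA0, zero_mul, Finset.sum_const_zero, Pi.smul_apply,
      smul_eq_mul] at this
    have := mul_pos hρ (hp i)
    linarith
  have hnum : p ⬝ᵥ (ρ⁻¹ • A).mulVec p = p ⬝ᵥ p := by
    rw [Matrix.smul_mulVec, hAp, smul_smul, inv_mul_cancel₀ hρ.ne', one_smul]
  have hn0 : (n : ℝ) ≠ 0 := by
    have : n ≠ 0 := by omega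
    exact_mod_cast this
  rw [hθinf, hnum]
  have : 2 / (n : ℝ) * (p ⬝ᵥ p) / (p ⬝ᵥ Ach.mulVec p) / 2
      = (n : ℝ)⁻¹ * (p ⬝ᵥ Ach.mulVec p)⁻¹ * (p ⬝ᵥ p) := by
    field_simp
  rw [this, mul_assoc, hk, mul_assoc, inv_mul_cancel_left₀ hne]
end

section
/- Let A be an n×n real symmetric matrix (n > 1) with nonnegative entries that is irreducible, let L = diag(A·1) − A be its Laplacian matrix, and let m > 0 satisfy m ≥ max_i L_{ii}. Define the balance-graph adjacency matrix Ã = m·I − L = m·I − diag(A·1) + A. Then à is a symmetric matrix with nonnegative entries and all row sums equal to m (so its Perron root is m), and for every α > 0, setting t = (m + α^{-1})^{-1}, one has (I − t·Ã)^{-1} = (αm + 1) · (I + αL)^{-1}; consequently, the walk distance built from R = (I − tÃ)^{-1}, namely d(i,j) = −ln( R_{ij}/√(R_{ii} R_{jj}) ), coincides for all i, j with the logarithmic forest distance built from Q = (I + αL)^{-1}, namely −ln( Q_{ij}/√(Q_{ii} Q_{jj}) ). -/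
open Matrix

/-- logarithmic forest distances are walk distances of a balance-graph.
With `L = diag(A·1) - A`, `m ≥ max_i L_ii`, `Ã = mI - L`, the matrix `Ã` is symmetric,
nonnegative, with all row sums `m`, and for `α > 0`, `t = (m + α⁻¹)⁻¹`, one has
`(I - tÃ)⁻¹ = (αm + 1)(I + αL)⁻¹`, whence the walk distance built from `(I - tÃ)⁻¹`
coincides with the logarithmic forest distance built from `(I + αL)⁻¹`. -/
theorem log_forest_distances_are_walk_distances
    {n : ℕ} (hn : 1 < n) (A : Matrix (Fin n) (Fin n) ℝ)
    (hsym : A.IsSymm) (hA : ∀ i j, 0 ≤ A i j)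
    (hirr : ∀ i j : Fin n, i ≠ j → ∃ k : ℕ, 1 ≤ k ∧ 0 < (A ^ k) i j)
    (L : Matrix (Fin n) (Fin n) ℝ)
    (hL : L = Matrix.diagonal (A.mulVec (fun _ => 1)) - A)
    (m : ℝ) (hm0 : 0 < m) (hm : ∀ i, L i i ≤ m)
    (At : Matrix (Fin n) (Fin n) ℝ)
    (hAt : At = m • (1 : Matrix (Fin n) (Fin n) ℝ) - L) :
    At.IsSymm ∧
    (∀ i j, 0 ≤ At i j) ∧
    (∀ i, ∑ j, At i j = m) ∧
    (∀ α : ℝ, 0 < α →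
      (1 - (m + α⁻¹)⁻¹ • At)⁻¹ =
        (α * m + 1) • (1 + α • L)⁻¹ ∧
      (∀ i j : Fin n,
        -Real.log ((1 - (m + α⁻¹)⁻¹ • At)⁻¹ i j /
          Real.sqrt ((1 - (m + α⁻¹)⁻¹ • At)⁻¹ i i * (1 - (m + α⁻¹)⁻¹ • At)⁻¹ j j)) =
        -Real.log ((1 + α • L)⁻¹ i j /
          Real.sqrt ((1 + α • L)⁻¹ i i * (1 + α • L)⁻¹ j j)))) := by
  have hLsum : ∀ i, ∑ j, L i j = 0 := by
    intro i
    simp [hL, Matrix.diagonal_apply, Matrix.mulVec, dotProduct, Finset.sum_sub_distrib]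
  refine ⟨?_, ?_, ?_, ?_⟩
  · rw [hAt, hL]
    simp [Matrix.IsSymm, Matrix.transpose_sub, hsym.eq]
  · intro i j
    by_cases h : i = j
    · subst h
      simp [hAt, hm i]
    · simp [hAt, hL, h, hA i j]
  · intro i
    simp [hAt, Finset.sum_sub_distrib, hLsum, Matrix.one_apply]
  · intro α hα
    have hc : 0 < α * m + 1 := by positivity
    have key : (1 - (m + α⁻¹)⁻¹ • At) = (α * m + 1)⁻¹ • (1 + α • L) := by
      have h1 : (m + α⁻¹)⁻¹ = α * (α * m + 1)⁻¹ := by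
        have : m + α⁻¹ ≠ 0 := by positivity
        field_simp
      rw [h1, hAt]
      ext i j
      simp only [Matrix.sub_apply, Matrix.smul_apply, Matrix.add_apply, smul_eq_mul]
      field_simp
      ring
    have hinv : (1 - (m + α⁻¹)⁻¹ • At)⁻¹ = (α * m + 1) • (1 + α • L)⁻¹ := by
      rw [key]
      by_cases hdet : IsUnit (1 + α • L).det
      · apply Matrix.inv_eq_left_inv
        rw [Matrix.smul_mul, Matrix.mul_smul, Matrix.nonsing_inv_mul _ hdet, smul_smul,
          mul_inv_cancel₀ hc.ne', one_smul]
      · have h0 : (1 + α • L).det = 0 := by simpa using hdet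
        rw [Matrix.nonsing_inv_apply_not_isUnit _ hdet, Matrix.nonsing_inv_apply_not_isUnit,
          smul_zero]
        rw [Matrix.det_smul, h0]
        simp
    refine ⟨hinv, fun i j => ?_⟩
    rw [hinv]
    simp only [Matrix.smul_apply, smul_eq_mul]
    rw [mul_mul_mul_comm, Real.sqrt_mul (by positivity), Real.sqrt_mul_self hc.le,
      mul_div_mul_left _ _ hc.ne']
end

section
/- Let A be an n×n real symmetric matrix (n > 1) with nonnegative entries that is irreducible, and let L = diag(A·1) − A be the Laplacian matrix of the connected graph G. Then for all indices i ≠ j, the submatrices L_ĵĵ and L_îî are invertible, and the resistance distance between i and j satisfies n^{-1} · ( ∑_{k ≠ j} ((L_ĵĵ)^{-1})_{ik} + ∑_{k ≠ i} ((L_îî)^{-1})_{jk} ) = g_{ii} + g_{jj} − 2·g_{ij}, where g = (L + n^{-1}·J)^{-1} and J is the all-ones n×n matrix (the right-hand side is the classical g-inverse expression for the resistance distance). -/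
open Matrix

lemma rd_energy {n : ℕ} (A : Matrix (Fin n) (Fin n) ℝ) (hsym : A.IsSymm) (x : Fin n → ℝ) :
    2 * (x ⬝ᵥ ((Matrix.diagonal (A.mulVec (fun _ => 1)) - A) *ᵥ x)) =
      ∑ i, ∑ j, A i j * (x i - x j) ^ 2 := by
  have h1 : x ⬝ᵥ ((Matrix.diagonal (A.mulVec (fun _ => 1)) - A) *ᵥ x) =
      ∑ i, ∑ j, (A i j * x i ^ 2 - A i j * x i * x j) := by
    simp only [dotProduct, Matrix.sub_mulVec, Matrix.mulVec_diagonal, Pi.sub_apply]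
    refine Finset.sum_congr rfl fun i _ => ?_
    simp only [mulVec, dotProduct, mul_one, Finset.sum_sub_distrib, mul_sub]
    rw [Finset.sum_mul, Finset.mul_sum, Finset.mul_sum]
    congr 1 <;> exact Finset.sum_congr rfl fun j _ => by ring
  have h2 : ∑ i, ∑ j, (A i j * x i ^ 2 - A i j * x i * x j) =
      ∑ i, ∑ j, (A i j * x j ^ 2 - A i j * x i * x j) := by
    rw [Finset.sum_comm]
    refine Finset.sum_congr rfl fun i _ => Finset.sum_congr rfl fun j _ => ?_
    rw [hsym.apply i j]; ring
  rw [two_mul, h1]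
  nth_rewrite 2 [h2]
  rw [← Finset.sum_add_distrib]
  refine Finset.sum_congr rfl fun i _ => ?_
  rw [← Finset.sum_add_distrib]
  exact Finset.sum_congr rfl fun j _ => by ring

lemma rd_energy_nonneg {n : ℕ} (A : Matrix (Fin n) (Fin n) ℝ) (hsym : A.IsSymm)
    (hA : ∀ i j, 0 ≤ A i j) (x : Fin n → ℝ) :
    0 ≤ x ⬝ᵥ ((Matrix.diagonal (A.mulVec (fun _ => 1)) - A) *ᵥ x) := by
  have h := rd_energy A hsym x
  have : 0 ≤ ∑ i, ∑ j, A i j * (x i - x j) ^ 2 :=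
    Finset.sum_nonneg fun i _ => Finset.sum_nonneg fun j _ => mul_nonneg (hA i j) (sq_nonneg _)
  linarith

lemma rd_const {n : ℕ} (A : Matrix (Fin n) (Fin n) ℝ) (hsym : A.IsSymm)
    (hA : ∀ i j, 0 ≤ A i j)
    (hirr : ∀ i j : Fin n, i ≠ j → ∃ k : ℕ, 1 ≤ k ∧ 0 < (A ^ k) i j) (x : Fin n → ℝ)
    (h0 : x ⬝ᵥ ((Matrix.diagonal (A.mulVec (fun _ => 1)) - A) *ᵥ x) = 0) (i j : Fin n) :
    x i = x j := by
  have h := rd_energy A hsym x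
  rw [h0, mul_zero] at h
  have hnn : ∀ i j, 0 ≤ A i j * (x i - x j) ^ 2 := fun i j => mul_nonneg (hA i j) (sq_nonneg _)
  have hz : ∀ i j, A i j ≠ 0 → x i = x j := by
    intro i j hne
    have h1 := (Finset.sum_eq_zero_iff_of_nonneg
      (fun i _ => Finset.sum_nonneg fun j _ => hnn i j)).1 h.symm i (Finset.mem_univ _)
    have h2 := (Finset.sum_eq_zero_iff_of_nonneg (fun j _ => hnn i j)).1 h1 j (Finset.mem_univ _)
    have h3 := (mul_eq_zero.1 h2).resolve_left hne
    exact sub_eq_zero.1 (pow_eq_zero_iff (two_ne_zero)|>.1 h3)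
  have hk : ∀ k : ℕ, ∀ i j, (A ^ k) i j ≠ 0 → x i = x j := by
    intro k
    induction k with
    | zero =>
      intro i j hne
      by_cases hij : i = j
      · rw [hij]
      · simp [Matrix.one_apply, hij] at hne
    | succ k ih =>
      intro i j hne
      rw [pow_succ, Matrix.mul_apply] at hne
      obtain ⟨l, _, hl⟩ := Finset.exists_ne_zero_of_sum_ne_zero hne
      exact (ih i l (left_ne_zero_of_mul hl)).trans (hz l j (right_ne_zero_of_mul hl))
  by_cases hij : i = j
  · rw [hij]
  · obtain ⟨k, _, hpos⟩ := hirr i j hij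
    exact hk k i j hpos.ne'

lemma rd_isUnit {m : Type*} [Fintype m] [DecidableEq m] (M : Matrix m m ℝ)
    (h : ∀ v, M *ᵥ v = 0 → v = 0) : IsUnit M.det := by
  rw [isUnit_iff_ne_zero]
  intro h0
  obtain ⟨v, hv, hv0⟩ := Matrix.exists_mulVec_eq_zero_iff.2 h0
  exact hv (h v hv0)

lemma rd_delSub_mulVec {n : ℕ} (L : Matrix (Fin n) (Fin n) ℝ) (j : Fin n) (x : Fin n → ℝ)
    (hx : x j = 0) (i : {i : Fin n // i ≠ j}) :
    (delSub L j *ᵥ (fun k => x k.1)) i = (L *ᵥ x) i.1 := by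
  simp only [mulVec, dotProduct, delSub, Matrix.submatrix_apply]
  rw [← Finset.sum_subtype (Finset.univ.filter fun k => k ≠ j) (by simp)
    (fun k => L i.1 k * x k)]
  apply Finset.sum_filter_of_ne
  intro k _ hk hkj
  apply hk
  rw [hkj, hx, mul_zero]

lemma rd_delSub_isUnit {n : ℕ} (A : Matrix (Fin n) (Fin n) ℝ) (hsym : A.IsSymm)
    (hA : ∀ i j, 0 ≤ A i j)
    (hirr : ∀ i j : Fin n, i ≠ j → ∃ k : ℕ, 1 ≤ k ∧ 0 < (A ^ k) i j) (j : Fin n) :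
    IsUnit (delSub (Matrix.diagonal (A.mulVec (fun _ => 1)) - A) j).det := by
  apply rd_isUnit
  intro v hv
  set x : Fin n → ℝ := fun k => if h : k ≠ j then v ⟨k, h⟩ else 0 with hxdef
  have hxj : x j = 0 := by simp [hxdef]
  have hxv : (fun k : {k : Fin n // k ≠ j} => x k.1) = v := by
    funext k
    simp [hxdef, k.2]
  have h0 : x ⬝ᵥ ((Matrix.diagonal (A.mulVec (fun _ => 1)) - A) *ᵥ x) = 0 := by
    apply Finset.sum_eq_zero
    intro k _
    by_cases hk : k = j
    · rw [hk, hxj, zero_mul]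
    · rw [← rd_delSub_mulVec _ j x hxj ⟨k, hk⟩, hxv, hv]; simp
  rw [← hxv]
  funext k
  rw [rd_const A hsym hA hirr x h0 k.1 j, hxj]; rfl

lemma rd_J_mulVec {n : ℕ} (x : Fin n → ℝ) (i : Fin n) :
    ((n : ℝ)⁻¹ • Matrix.of (fun _ _ : Fin n => (1 : ℝ)) *ᵥ x) i = (n : ℝ)⁻¹ * ∑ k, x k := by
  simp [mulVec, dotProduct]

/-- for the Laplacian `L` of a connected graph, the submatrices `L_ĵĵ` are
invertible and the resistance distance formula
`n⁻¹(∑_{k≠j}((L_ĵĵ)⁻¹)_{ik} + ∑_{k≠i}((L_îî)⁻¹)_{jk}) = g_ii + g_jj - 2g_ij`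
holds, where `g = (L + n⁻¹J)⁻¹`. -/
theorem resistance_distance_g_inverse_formula
    {n : ℕ} (hn : 1 < n) (A : Matrix (Fin n) (Fin n) ℝ)
    (hsym : A.IsSymm) (hA : ∀ i j, 0 ≤ A i j)
    (hirr : ∀ i j : Fin n, i ≠ j → ∃ k : ℕ, 1 ≤ k ∧ 0 < (A ^ k) i j)
    (L : Matrix (Fin n) (Fin n) ℝ)
    (hL : L = Matrix.diagonal (A.mulVec (fun _ => 1)) - A)
    (g : Matrix (Fin n) (Fin n) ℝ)
    (hg : g = (L + (n : ℝ)⁻¹ • Matrix.of (fun _ _ : Fin n => (1 : ℝ)))⁻¹) :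
    ∀ i j : Fin n, ∀ hij : i ≠ j,
      IsUnit (delSub L j).det ∧ IsUnit (delSub L i).det ∧
      (n : ℝ)⁻¹ *
        ((∑ k : {k : Fin n // k ≠ j}, (delSub L j)⁻¹ ⟨i, hij⟩ k) +
         (∑ k : {k : Fin n // k ≠ i}, (delSub L i)⁻¹ ⟨j, hij.symm⟩ k)) =
      g i i + g j j - 2 * g i j := by
  have hn0 : (n : ℝ) ≠ 0 := by positivity
  have hLs : L.IsSymm := by
    rw [hL]
    exact (Matrix.isSymm_diagonal _).sub hsym
  set J : Matrix (Fin n) (Fin n) ℝ := Matrix.of (fun _ _ : Fin n => (1 : ℝ)) with hJ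
  have hJs : J.IsSymm := by ext a b; rfl
  have hMu : IsUnit (L + (n : ℝ)⁻¹ • J).det := by
    apply rd_isUnit
    intro v hv
    have hJv : ∀ i, (((n : ℝ)⁻¹ • J) *ᵥ v) i = (n : ℝ)⁻¹ * ∑ k, v k := by
      intro i
      rw [Matrix.smul_mulVec]; exact rd_J_mulVec v i
    have h1 : v ⬝ᵥ (L *ᵥ v) + (n : ℝ)⁻¹ * (∑ k, v k) ^ 2 = 0 := by
      have : v ⬝ᵥ ((L + (n : ℝ)⁻¹ • J) *ᵥ v) = 0 := by rw [hv]; simp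
      rw [Matrix.add_mulVec, dotProduct_add] at this
      rw [← this]
      congr 1
      simp only [dotProduct, hJv]
      rw [← Finset.sum_mul]; ring
    have h2 : 0 ≤ v ⬝ᵥ (L *ᵥ v) := by rw [hL]; exact rd_energy_nonneg A hsym hA v
    have h3 : 0 ≤ (n : ℝ)⁻¹ * (∑ k, v k) ^ 2 := by positivity
    have h4 : v ⬝ᵥ (L *ᵥ v) = 0 := by linarith
    have h5 : (n : ℝ)⁻¹ * (∑ k, v k) ^ 2 = 0 := by linarith
    have h6 : ∑ k, v k = 0 := by simpa [hn0] using h5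
    rw [hL] at h4
    funext i
    have h7 : ∑ k, v k = ∑ _k : Fin n, v i :=
      Finset.sum_congr rfl fun k _ => rd_const A hsym hA hirr v h4 k i
    rw [h6] at h7
    simpa [hn0] using h7.symm
  have hMs : (L + (n : ℝ)⁻¹ • J).IsSymm := hLs.add (hJs.smul _)
  have hgs : g.IsSymm := by
    rw [hg, Matrix.IsSymm, Matrix.transpose_nonsing_inv, hMs.eq]
  have hMg : (L + (n : ℝ)⁻¹ • J) * g = 1 := by rw [hg]; exact Matrix.mul_nonsing_inv _ hMu
  have hgM : g * (L + (n : ℝ)⁻¹ • J) = 1 := by rw [hg]; exact Matrix.nonsing_inv_mul _ hMu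
  have hL1 : L *ᵥ (fun _ => 1) = 0 := by
    rw [hL]; funext i
    simp [Matrix.sub_mulVec, Matrix.mulVec_diagonal]
  have hM1 : (L + (n : ℝ)⁻¹ • J) *ᵥ (fun _ => 1) = fun _ => 1 := by
    rw [Matrix.add_mulVec, hL1, zero_add]
    funext i
    rw [Matrix.smul_mulVec]
    refine (rd_J_mulVec _ i).trans ?_
    simp [hn0]
  have hg1 : g *ᵥ (fun _ => 1) = fun _ => 1 := by
    conv_lhs => rw [← hM1]
    rw [Matrix.mulVec_mulVec, hgM, Matrix.one_mulVec]
  have hgcol : ∀ j, ∑ k, g k j = 1 := by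
    intro j
    have := congrFun hg1 j
    simp only [mulVec, dotProduct, mul_one] at this
    rw [← this]
    exact Finset.sum_congr rfl fun k _ => hgs.apply j k
  have key : ∀ i j : Fin n, ∀ hij : i ≠ j, IsUnit (delSub L j).det ∧
      (∑ k : {k : Fin n // k ≠ j}, (delSub L j)⁻¹ ⟨i, hij⟩ k) = n * (g j j - g i j) := by
    intro i j hij
    have hu : IsUnit (delSub L j).det := by
      rw [hL]; exact rd_delSub_isUnit A hsym hA hirr j
    refine ⟨hu, ?_⟩
    have hLg : ∀ k, k ≠ j → (L *ᵥ (fun l => g l j)) k = - (n : ℝ)⁻¹ := by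
      intro k hk
      have h1 := congrFun (congrFun hMg k) j
      rw [Matrix.add_mul, Matrix.add_apply, Matrix.one_apply_ne hk] at h1
      have h2 : (((n : ℝ)⁻¹ • J) * g) k j = (n : ℝ)⁻¹ := by
        simp [Matrix.mul_apply, hJ, ← Finset.mul_sum, hgcol]
      rw [h2] at h1
      have h3 : (L *ᵥ (fun l => g l j)) k = (L * g) k j := rfl
      rw [h3]; linarith
    set x : Fin n → ℝ := fun k => n * (g j j - g k j) with hx
    have hxj : x j = 0 := by simp [hx]
    have hxe : x = ((n : ℝ) * g j j) • (fun _ => (1 : ℝ)) - (n : ℝ) • (fun k => g k j) := by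
      funext k; simp [hx]; ring
    have hLx : ∀ k, k ≠ j → (L *ᵥ x) k = 1 := by
      intro k hk
      rw [hxe, Matrix.mulVec_sub, Matrix.mulVec_smul, Matrix.mulVec_smul, hL1]
      simp [hLg k hk, hn0]
    have hd : delSub L j *ᵥ (fun k => x k.1) = fun _ => 1 := by
      funext k
      rw [rd_delSub_mulVec L j x hxj k, hLx k.1 k.2]
    have hy : (delSub L j)⁻¹ *ᵥ (fun _ => 1) = fun k => x k.1 := by
      rw [← hd, Matrix.mulVec_mulVec, Matrix.nonsing_inv_mul _ hu, Matrix.one_mulVec]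
    have := congrFun hy ⟨i, hij⟩
    simpa [mulVec, dotProduct] using this
  intro i j hij
  obtain ⟨u1, e1⟩ := key i j hij
  obtain ⟨u2, e2⟩ := key j i hij.symm
  refine ⟨u1, u2, ?_⟩
  rw [e1, e2, hgs.apply i j]
  field_simp
  ring
end
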